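/- arXiv:2509.16514 — 4 statements merged into one kernel-verified Lean document; each statement's English description precedes it below -/
import Mathlib

section
/- The set of pairs of integers (n,m) with n ∈ {5,6,7}, 0 ≤ m ≤ C(n,2), M₁(S¹_{n,m}) = M₁(C¹_{n,m}), and m ∉ {i, C(n,2)−i : i ∈ {0,1,2,3}} is exactly {(5,5), (6,6), (6,7), (6,8), (6,9), (7,9), (7,12)}. -/
noncomputable def edgeCount {V : Type} (G : SimpleGraph V) : ℕ := G.edgeSet.ncard

noncomputable def M1 {V : Type} [Fintype V] (G : SimpleGraph V) : ℕ :=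
  ∑ v : V, (G.neighborSet v).ncard ^ 2

open Classical in
/-- Second Zagreb index: each unordered edge counted once (ordered sum halved). -/
noncomputable def M2 {V : Type} [Fintype V] (G : SimpleGraph V) : ℕ :=
  (∑ u : V, ∑ v : V,
    if G.Adj u v then (G.neighborSet u).ncard * (G.neighborSet v).ncard else 0) / 2

noncomputable def k3 {V : Type} [Fintype V] (G : SimpleGraph V) : ℕ :=
  {s : Finset V | G.IsNClique 3 s}.ncard

noncomputable def Hval {V : Type} [Fintype V] (G : SimpleGraph V) : ℤ :=
  (M2 G : ℤ) - 6 * (k3 G : ℤ)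

/-- `G` is M-optimal among simple graphs on `V` with `m` edges. -/
def MOptimal {V : Type} [Fintype V] (m : ℕ) (G : SimpleGraph V) : Prop :=
  edgeCount G = m ∧ ∀ G' : SimpleGraph V, edgeCount G' = m → M1 G' ≤ M1 G

/-- `G` is H-optimal among simple graphs on `V` with `m` edges. -/
def HOptimal {V : Type} [Fintype V] (m : ℕ) (G : SimpleGraph V) : Prop :=
  MOptimal m G ∧ ∀ G' : SimpleGraph V, MOptimal m G' → Hval G' ≤ Hval G

/-- A two-terminal graph on `n` labeled vertices. -/
structure TwoTerminalGraph (n : ℕ) where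
  graph : SimpleGraph (Fin n)
  s : Fin n
  t : Fin n
  hst : s ≠ t

/-- The set of two-terminal graphs on `n` vertices with `m` edges. -/
def TT (n m : ℕ) : Set (TwoTerminalGraph n) := {G | edgeCount G.graph = m}

/-- `Ncoeff G i` = number of `i`-edge subsets `F` of `E(G)` such that the terminals
are joined by a path in the spanning subgraph `(V, F)`. -/
noncomputable def Ncoeff {n : ℕ} (G : TwoTerminalGraph n) (i : ℕ) : ℕ :=
  {F : Set (Sym2 (Fin n)) | F ⊆ G.graph.edgeSet ∧ F.ncard = i ∧
    (SimpleGraph.fromEdgeSet F).Reachable G.s G.t}.ncard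

/-- Two-terminal reliability at `p`, for a graph with `m` edges. -/
noncomputable def relia {n : ℕ} (m : ℕ) (G : TwoTerminalGraph n) (p : ℝ) : ℝ :=
  ∑ i ∈ Finset.Icc 1 m, (Ncoeff G i : ℝ) * p ^ i * (1 - p) ^ (m - i)

/-- Locally most reliable two-terminal graph in `TT n m`. -/
def IsLMRTTG (n m : ℕ) (G : TwoTerminalGraph n) : Prop :=
  G ∈ TT n m ∧ ∀ H ∈ TT n m, ∃ δ > 0, ∀ p ∈ Set.Ioo (0:ℝ) δ, relia m H p ≤ relia m G p

/-- Isomorphism of two-terminal graphs: a graph isomorphism mapping terminals to terminals. -/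
def TTIso {n : ℕ} (G H : TwoTerminalGraph n) : Prop :=
  ∃ e : G.graph ≃g H.graph, (e G.s = H.s ∧ e G.t = H.t) ∨ (e G.s = H.t ∧ e G.t = H.s)

/-- The iterated maximizing subsets `T_{n,m}^{(i)}`. -/
def TTfilter (n m : ℕ) : ℕ → Set (TwoTerminalGraph n)
  | 0 => TT n m
  | i + 1 => {G ∈ TTfilter n m i | ∀ H ∈ TTfilter n m i, Ncoeff H (i+1) ≤ Ncoeff G (i+1)}

/-- The quasi-complete graph `C¹_{n,m}` with parameters `k, j`
(`m = C(k+1,2) − j`, `1 ≤ j ≤ k`): a `K_k` on vertices `0..k-1`, one extra vertex `k`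
adjacent to exactly `k−j` vertices of the clique, and `n−k−1` isolated vertices. -/
def quasiComplete (n k j : ℕ) : SimpleGraph (Fin n) :=
  SimpleGraph.fromRel (fun a b => (a.val < k ∧ b.val < k) ∨ (a.val = k ∧ b.val < k - j))

/-- The quasi-star graph `S¹_{n,m}` with parameters `k', j'`
(`m = C(n,2) − C(k'+1,2) + j'`): the complement of the quasi-complete graph,
i.e. `K_{n−k'−1} ∨ ((K_1 ∨ j'K_1) ∪ (k'−j')K_1)`. -/
def quasiStar (n k' j' : ℕ) : SimpleGraph (Fin n) := (quasiComplete n k' j')ᶜ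

/-- `S²_{n,m} = K_{n−2k'+j'} ∨ ((K_{k'−j'} ∨ (k'−1)K_1) ∪ K_1)`. -/
def quasiStar2 (n k' j' : ℕ) : SimpleGraph (Fin n) :=
  SimpleGraph.fromRel (fun x y =>
    x.val < n - 2*k' + j' ∨
    (n - 2*k' + j' ≤ x.val ∧ x.val < n - k' ∧ n - 2*k' + j' ≤ y.val ∧ y.val < n - k') ∨
    (n - 2*k' + j' ≤ x.val ∧ x.val < n - k' ∧ n - k' ≤ y.val ∧ y.val < n - 1))

/-- `S³_{n,m} = K_{n−k'−1} ∨ (K_3 ∪ (k'−2)K_1)` (defined when `j' = 3`). -/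
def quasiStar3 (n k' : ℕ) : SimpleGraph (Fin n) :=
  SimpleGraph.fromRel (fun x y =>
    x.val < n - k' - 1 ∨
    (n - k' - 1 ≤ x.val ∧ x.val < n - k' + 2 ∧ n - k' - 1 ≤ y.val ∧ y.val < n - k' + 2))

/-- `C³_{n,m} = (K_{k−2} ∨ 3K_1) ∪ (n−k−1)K_1` (defined when `j = 3`). -/
def quasiComplete3 (n k : ℕ) : SimpleGraph (Fin n) :=
  SimpleGraph.fromRel (fun x y =>
    (x.val < k - 2 ∧ y.val < k - 2) ∨ (x.val < k - 2 ∧ k - 2 ≤ y.val ∧ y.val < k + 1))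

noncomputable def pPoly (x : ℝ) : ℝ :=
  (1/8) * ((3 - 2*Real.sqrt 2)*x^4 - (20 + 37*Real.sqrt 2)*x^3
    + (19 + 76*Real.sqrt 2)*x^2 - (46 + 226*Real.sqrt 2)*x + 72)

noncomputable def qPoly (x : ℝ) : ℝ :=
  (1/8) * (2*Real.sqrt 2*x^3 - 2*x^2 - 16*Real.sqrt 2*x + 4)

/-- The family `S^i_{n,m}` for `i ∈ {1,2,3}`. -/
def Sfam (n k' j' : ℕ) : ℕ → SimpleGraph (Fin n)
  | 1 => quasiStar n k' j'
  | 2 => quasiStar2 n k' j'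
  | 3 => quasiStar3 n k'
  | _ => ⊥

/-- Existence conditions for `S^i_{n,m}`, `i ∈ {1,2,3}`. -/
def SExists (n k' j' : ℕ) : ℕ → Prop
  | 1 => True
  | 2 => k' + 1 ≤ 2*k' - j' - 1 ∧ 2*k' - j' - 1 ≤ n - 1
  | 3 => j' = 3
  | _ => False


def qcB (k j a b : ℕ) : Bool :=
  decide (a ≠ b) && ((decide (a < k) && decide (b < k)) || (decide (a = k) && decide (b < k - j)) ||
    (decide (b < k) && decide (a < k)) || (decide (b = k) && decide (a < k - j)))

def cC (n k j : ℕ) : ℕ :=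
  ∑ v : Fin n, (Finset.univ.filter (fun w : Fin n => qcB k j v.val w.val = true)).card ^ 2

def cS (n k j : ℕ) : ℕ :=
  ∑ v : Fin n, (Finset.univ.filter
    (fun w : Fin n => (decide (v.val ≠ w.val) && !qcB k j v.val w.val) = true)).card ^ 2

lemma qc_adj (n k j : ℕ) (a b : Fin n) :
    (quasiComplete n k j).Adj a b ↔ qcB k j a.val b.val = true := by
  simp [quasiComplete, qcB, SimpleGraph.fromRel_adj, Fin.ext_iff]
  tauto

lemma M1_C (n k j : ℕ) : M1 (quasiComplete n k j) = cC n k j := by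
  unfold M1 cC
  refine Finset.sum_congr rfl fun v _ => ?_
  congr 1
  rw [← Set.ncard_coe_finset]
  congr 1
  ext w
  simp [qc_adj]

lemma M1_S (n k j : ℕ) : M1 (quasiStar n k j) = cS n k j := by
  unfold M1 cS
  refine Finset.sum_congr rfl fun v _ => ?_
  congr 1
  rw [← Set.ncard_coe_finset]
  congr 1
  ext w
  simp [quasiStar, qc_adj, Fin.ext_iff]

lemma le7 (k : ℕ) (h : (k+1).choose 2 ≤ 21 + k) : k ≤ 7 := by
  by_contra hk
  have h1 : (k+1).choose 2 = k + k.choose 2 := by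
    rw [Nat.choose_succ_succ' k 1, Nat.choose_one_right]
  have h2 : Nat.choose 8 2 ≤ k.choose 2 := Nat.choose_le_choose 2 (by omega)
  have h3 : Nat.choose 8 2 = 28 := by decide
  omega

def okSet : List (ℕ × ℕ) := [(5,5), (6,6), (6,7), (6,8), (6,9), (7,9), (7,12)]

set_option synthInstance.maxHeartbeats 400000 in
set_option synthInstance.maxSize 4000 in
lemma fin_check : ∀ n ∈ [5,6,7], ∀ k < 8, ∀ j < 8, ∀ k' < 8, ∀ j' < 8,
    (1 ≤ j ∧ j ≤ k ∧ 1 ≤ j' ∧ j' ≤ k' ∧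
    (k+1).choose 2 - j + (k'+1).choose 2 = n.choose 2 + j' ∧
    3 < (k+1).choose 2 - j ∧ (k+1).choose 2 - j + 3 < n.choose 2 ∧
    cS n k' j' = cC n k j) → (n, (k+1).choose 2 - j) ∈ okSet := by
  decide +kernel

theorem stmt11 (n m : ℕ) :
    ((n = 5 ∨ n = 6 ∨ n = 7) ∧ m ≤ n.choose 2 ∧
      (∃ k j k' j' : ℕ, 1 ≤ j ∧ j ≤ k ∧ m + j = (k+1).choose 2 ∧
        1 ≤ j' ∧ j' ≤ k' ∧ m + (k'+1).choose 2 = n.choose 2 + j' ∧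
        M1 (quasiStar n k' j') = M1 (quasiComplete n k j)) ∧
      ¬(m = 0 ∨ m = 1 ∨ m = 2 ∨ m = 3 ∨ m = n.choose 2 ∨ m = n.choose 2 - 1 ∨
        m = n.choose 2 - 2 ∨ m = n.choose 2 - 3)) ↔
    (n, m) ∈ ({(5,5), (6,6), (6,7), (6,8), (6,9), (7,9), (7,12)} : Set (ℕ × ℕ)) := by
  constructor
  · rintro ⟨hn, hm, ⟨k, j, k', j', h1, h2, h3, h4, h5, h6, h7⟩, hne⟩
    rw [M1_C, M1_S] at h7
    have hc : 10 ≤ n.choose 2 ∧ n.choose 2 ≤ 21 := by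
      rcases hn with rfl | rfl | rfl <;> decide
    have hk : k ≤ 7 := le7 k (by omega)
    have hk' : k' ≤ 7 := le7 k' (by omega)
    have hme : m = (k+1).choose 2 - j := by omega
    have := fin_check n (by simpa using hn) k (by omega) j (by omega) k' (by omega) j' (by omega)
      ⟨h1, h2, h4, h5, by omega, by omega, by omega, h7⟩
    rw [← hme] at this
    simpa [okSet] using this
  · intro h
    simp only [Set.mem_insert_iff, Set.mem_singleton_iff, Prod.mk.injEq] at h
    simp only [M1_C, M1_S]
    have key : ∀ p ∈ okSet, (p.1 = 5 ∨ p.1 = 6 ∨ p.1 = 7) ∧ p.2 ≤ p.1.choose 2 ∧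
      (∃ k < 8, ∃ j < 8, ∃ k' < 8, ∃ j' < 8, 1 ≤ j ∧ j ≤ k ∧ p.2 + j = (k+1).choose 2 ∧
        1 ≤ j' ∧ j' ≤ k' ∧ p.2 + (k'+1).choose 2 = p.1.choose 2 + j' ∧
        cS p.1 k' j' = cC p.1 k j) ∧
      ¬(p.2 = 0 ∨ p.2 = 1 ∨ p.2 = 2 ∨ p.2 = 3 ∨ p.2 = p.1.choose 2 ∨ p.2 = p.1.choose 2 - 1 ∨
        p.2 = p.1.choose 2 - 2 ∨ p.2 = p.1.choose 2 - 3) := by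
      decide +kernel
    obtain ⟨a, b, ⟨k, _, j, _, k', _, j', _, hh⟩, d⟩ := key (n, m) (by simpa [okSet] using h)
    exact ⟨a, b, ⟨k, j, k', j', hh⟩, d⟩
end

section
/- Let n and m be integers with n ≥ 8 and (1/2)C(n,2) − n/2 ≤ m ≤ (1/2)C(n,2) + n/2. Let k, j be the unique integers with 1 ≤ j ≤ k and m = C(k+1,2) − j, and let k', j' be the unique integers with 1 ≤ j' ≤ k' and m = C(n,2) − C(k'+1,2) + j'. Then n/√2 − 2 < k < n/√2 + 1 and n/√2 − 2 < k' < n/√2 + 1. -/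
theorem stmt13_aux (n k j M : ℝ) (hn : 8 ≤ n) (hj : 1 ≤ j) (hjk : j ≤ k)
    (h1 : n * (n - 1) / 2 / 2 - n / 2 ≤ M) (h2 : M ≤ n * (n - 1) / 2 / 2 + n / 2)
    (hM : M + j = (k + 1) * k / 2) :
    n / Real.sqrt 2 - 2 < k ∧ k < n / Real.sqrt 2 + 1 := by
  have hs : Real.sqrt 2 * Real.sqrt 2 = 2 := Real.mul_self_sqrt (by norm_num)
  have hs0 : 0 < Real.sqrt 2 := by positivity
  obtain ⟨x, hx⟩ : ∃ x, x = n / Real.sqrt 2 := ⟨_, rfl⟩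
  rw [← hx]
  have hnx : n = x * Real.sqrt 2 := by rw [hx]; field_simp
  have hx0 : 0 < x := by rw [hx]; positivity
  have hn2 : n * n = 2 * (x * x) := by
    rw [hnx]; linear_combination (x * x) * hs
  have hlt : n < 2 * x := by nlinarith
  constructor
  · by_contra! h
    have h3 : (k + 1) * k ≤ (x - 1) * (x - 2) := by
      apply mul_le_mul <;> linarith
    have : x < n := by nlinarith
    nlinarith
  · by_contra! h
    have h3 : (x + 1) * x ≤ k * (k - 1) := by
      apply mul_le_mul <;> linarith
    nlinarith

theorem stmt13 (n m k j k' j' : ℕ) (hn : 8 ≤ n)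
    (hm1 : ((n.choose 2 : ℕ) : ℚ)/2 - (n:ℚ)/2 ≤ (m:ℚ))
    (hm2 : (m:ℚ) ≤ ((n.choose 2 : ℕ) : ℚ)/2 + (n:ℚ)/2)
    (hj : 1 ≤ j) (hjk : j ≤ k) (hkj : m + j = (k+1).choose 2)
    (hj' : 1 ≤ j') (hjk' : j' ≤ k') (hkj' : m + (k'+1).choose 2 = n.choose 2 + j') :
    ((n:ℝ) / Real.sqrt 2 - 2 < (k:ℝ) ∧ (k:ℝ) < (n:ℝ) / Real.sqrt 2 + 1) ∧
      ((n:ℝ) / Real.sqrt 2 - 2 < (k':ℝ) ∧ (k':ℝ) < (n:ℝ) / Real.sqrt 2 + 1) := by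
  have e1 : ((n.choose 2 : ℕ) : ℝ) = (n:ℝ) * ((n:ℝ) - 1) / 2 := Nat.cast_choose_two ℝ n
  have e2 : (((k+1).choose 2 : ℕ) : ℝ) = ((k:ℝ) + 1) * k / 2 := by
    rw [Nat.cast_choose_two]; push_cast; ring
  have e3 : (((k'+1).choose 2 : ℕ) : ℝ) = ((k':ℝ) + 1) * k' / 2 := by
    rw [Nat.cast_choose_two]; push_cast; ring
  have a1 : ((n.choose 2 : ℕ) : ℝ)/2 - (n:ℝ)/2 ≤ (m:ℝ) := by
    have h := (Rat.cast_le (K := ℝ)).mpr hm1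
    push_cast at h
    exact h
  have a2 : (m:ℝ) ≤ ((n.choose 2 : ℕ) : ℝ)/2 + (n:ℝ)/2 := by
    have h := (Rat.cast_le (K := ℝ)).mpr hm2
    push_cast at h
    exact h
  have a3 : (m:ℝ) + j = (((k+1).choose 2 : ℕ) : ℝ) := by exact_mod_cast hkj
  have a4 : (m:ℝ) + (((k'+1).choose 2 : ℕ) : ℝ) = ((n.choose 2 : ℕ) : ℝ) + j' := by
    exact_mod_cast hkj'
  rw [e1] at a1 a2 a4
  rw [e2] at a3
  rw [e3] at a4
  have hn' : (8:ℝ) ≤ n := by exact_mod_cast hn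
  constructor
  · exact stmt13_aux n k j m hn' (by exact_mod_cast hj) (by exact_mod_cast hjk) a1 a2 a3
  · exact stmt13_aux n k' j' ((n:ℝ) * ((n:ℝ) - 1) / 2 - m) hn' (by exact_mod_cast hj')
      (by exact_mod_cast hjk') (by linarith) (by linarith) (by linarith)
end

section
/- Let n and m be integers with n ≥ 8 and (1/2)C(n,2) − n/2 ≤ m ≤ (1/2)C(n,2) + n/2. Then H(C¹_{n,m}) − H(S¹_{n,m}) ≥ p(n), where p(x) = (1/8)·((3−2√2)x⁴ − (20+37√2)x³ + (19+76√2)x² − (46+226√2)x + 72). -/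
lemma M2_qc (n k j : ℕ) (hk : k < n) :
    (k:ℝ) * (k-1) * ((k:ℝ)-1)^2 / 2 - 1 ≤ (M2 (quasiComplete n k j) : ℝ) := by
  classical
  have hdeg : ∀ u : Fin n, u.val < k → k - 1 ≤ ((quasiComplete n k j).neighborSet u).ncard := by
    intro u hu
    have hsub : ((((Finset.univ : Finset (Fin n)).filter (fun v => v.val < k)).erase u : Finset (Fin n)) : Set (Fin n))
        ⊆ (quasiComplete n k j).neighborSet u := by
      intro v hv
      simp only [Finset.coe_erase, Finset.coe_filter, Finset.mem_univ, true_and, Set.mem_sdiff, Set.mem_ofPred_eq,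
        Set.mem_singleton_iff] at hv
      simp only [quasiComplete, SimpleGraph.mem_neighborSet, SimpleGraph.fromRel_adj]
      exact ⟨fun h => hv.2 h.symm, Or.inl (Or.inl ⟨hu, hv.1⟩)⟩
    have := Set.ncard_le_ncard hsub (Set.toFinite _)
    rw [Set.ncard_coe_finset, Finset.card_erase_of_mem (by simp [hu])] at this
    have hc : ((Finset.univ : Finset (Fin n)).filter (fun v => v.val < k)).card = k := by
      rw [Fin.card_filter_val_lt]; omega
    omega
  set s := (Finset.univ : Finset (Fin n)).filter (fun v => v.val < k) with hs
  have hc : s.card = k := by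
    rw [hs, Fin.card_filter_val_lt]; omega
  have h1 : k * ((k-1) * ((k-1)*(k-1))) ≤ ∑ u : Fin n, ∑ v : Fin n,
    if (quasiComplete n k j).Adj u v then ((quasiComplete n k j).neighborSet u).ncard * ((quasiComplete n k j).neighborSet v).ncard else 0 := by
    calc k * ((k-1) * ((k-1)*(k-1))) = ∑ u ∈ s, ∑ v ∈ s.erase u, (k-1)*(k-1) := by
          rw [Finset.sum_congr rfl (g := fun _ => (k-1) * ((k-1)*(k-1)))]
          · simp [hc]
          · intro u hu
            simp [Finset.card_erase_of_mem hu, hc]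
      _ ≤ ∑ u ∈ s, ∑ v ∈ s.erase u, if (quasiComplete n k j).Adj u v then ((quasiComplete n k j).neighborSet u).ncard * ((quasiComplete n k j).neighborSet v).ncard else 0 := by
          refine Finset.sum_le_sum fun u hu => Finset.sum_le_sum fun v hv => ?_
          have hu' : u.val < k := by simpa [hs] using hu
          have hv' : v ≠ u ∧ v.val < k := by simpa [hs] using hv
          have : (quasiComplete n k j).Adj u v := by
            simp only [quasiComplete, SimpleGraph.fromRel_adj]
            exact ⟨hv'.1.symm, Or.inl (Or.inl ⟨hu', hv'.2⟩)⟩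
          rw [if_pos this]
          exact Nat.mul_le_mul (hdeg u hu') (hdeg v hv'.2)
      _ ≤ ∑ u ∈ s, ∑ v : Fin n, if (quasiComplete n k j).Adj u v then ((quasiComplete n k j).neighborSet u).ncard * ((quasiComplete n k j).neighborSet v).ncard else 0 :=
          Finset.sum_le_sum fun u hu => Finset.sum_le_sum_of_subset (Finset.subset_univ _)
      _ ≤ _ := Finset.sum_le_sum_of_subset (Finset.subset_univ _)
  have h2 : k * ((k-1) * ((k-1)*(k-1))) / 2 ≤ M2 (quasiComplete n k j) := by
    unfold M2
    refine Nat.div_le_div_right (h1.trans (le_of_eq ?_))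
    refine Finset.sum_congr rfl fun u _ => Finset.sum_congr rfl fun v _ => ?_
    congr
  have h3 : k * ((k-1) * ((k-1)*(k-1))) ≤ 2 * M2 (quasiComplete n k j) + 1 := by omega
  rcases Nat.eq_zero_or_pos k with h0 | h0
  · subst h0
    have : (0:ℝ) ≤ (M2 (quasiComplete n 0 j) : ℝ) := Nat.cast_nonneg _
    push_cast; linarith
  · have h4 : (k:ℝ) * (((k:ℝ)-1) * (((k:ℝ)-1)*((k:ℝ)-1))) ≤ 2 * (M2 (quasiComplete n k j) : ℝ) + 1 := by
      have := (Nat.cast_le (α := ℝ)).2 h3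
      push_cast [Nat.cast_sub (show 1 ≤ k from h0)] at this
      exact this
    nlinarith

lemma k3_qc (n k j : ℕ) (hk : k < n) :
    6 * (k3 (quasiComplete n k j) : ℝ) ≤ ((k:ℝ)+1) * k * (k-1) := by
  classical
  set s := (Finset.univ : Finset (Fin n)).filter (fun v => v.val < k + 1) with hs
  have hc : s.card = k + 1 := by
    rw [hs, Fin.card_filter_val_lt]; omega
  have hsub : {t : Finset (Fin n) | (quasiComplete n k j).IsNClique 3 t} ⊆ ((s.powersetCard 3 : Finset (Finset (Fin n))) : Set (Finset (Fin n))) := by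
    intro t ht
    have ht' : (quasiComplete n k j).IsNClique 3 t := ht
    simp only [Finset.mem_coe, Finset.mem_powersetCard]
    refine ⟨?_, ht'.card_eq⟩
    intro x hx
    obtain ⟨y, hy, hxy⟩ := Finset.exists_mem_ne (by rw [ht'.card_eq]; norm_num) x
    have := ht'.isClique hx hy hxy.symm
    simp only [quasiComplete, SimpleGraph.fromRel_adj] at this
    simp only [hs, Finset.mem_filter, Finset.mem_univ, true_and]
    omega
  have h := Set.ncard_le_ncard hsub (Set.toFinite _)
  rw [Set.ncard_coe_finset, Finset.card_powersetCard, hc] at h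
  have h6 : 6 * (k+1).choose 3 = (k+1) * k * (k-1) := by
    have := Nat.descFactorial_eq_factorial_mul_choose (k+1) 3
    simp [Nat.descFactorial, Nat.factorial] at this
    rw [← this]
    ring
  have h7 : 6 * k3 (quasiComplete n k j) ≤ (k+1) * k * (k-1) := by
    rw [← h6]; exact Nat.mul_le_mul_left _ h
  rcases Nat.eq_zero_or_pos k with h0 | h0
  · subst h0
    have h8 := (Nat.cast_le (α := ℝ)).2 h7
    push_cast at h8 ⊢
    linarith
  · have h8 := (Nat.cast_le (α := ℝ)).2 h7
    push_cast [Nat.cast_sub (show 1 ≤ k from h0)] at h8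
    exact h8

lemma M2_qs (n k b j : ℕ) (hk : k + b = n) (hb : 1 ≤ b) :
    (M2 (quasiStar n k j) : ℝ) ≤ (b:ℝ) * (b-1) * (n-1)^2 / 2 + (k:ℝ) * b * (b * (n-1)) := by
  classical
  have hdeg1 : ∀ u : Fin n, ((quasiStar n k j).neighborSet u).ncard ≤ n - 1 := by
    intro u
    have hsub : (quasiStar n k j).neighborSet u ⊆ (((Finset.univ : Finset (Fin n)).erase u : Finset (Fin n)) : Set (Fin n)) := by
      intro v hv
      have : (quasiStar n k j).Adj u v := hv
      simpa using this.ne'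
    have := Set.ncard_le_ncard hsub (Set.toFinite _)
    rw [Set.ncard_coe_finset, Finset.card_erase_of_mem (by simp)] at this
    simpa using this
  have hadj : ∀ u v : Fin n, (quasiStar n k j).Adj u v → u.val < k → ¬ v.val < k := by
    intro u v h hu hv
    simp only [quasiStar, SimpleGraph.compl_adj, quasiComplete, SimpleGraph.fromRel_adj] at h
    exact h.2 ⟨h.1, Or.inl (Or.inl ⟨hu, hv⟩)⟩
  set s := (Finset.univ : Finset (Fin n)).filter (fun v => v.val < k) with hs
  set t := (Finset.univ : Finset (Fin n)).filter (fun v => ¬ v.val < k) with ht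
  have hsc : s.card = k := by
    rw [hs, Fin.card_filter_val_lt]; omega
  have htc : t.card = b := by
    have := Finset.card_filter_add_card_filter_not (s := (Finset.univ : Finset (Fin n))) (fun v => v.val < k)
    rw [← hs, ← ht, hsc] at this
    simp at this; omega
  have hdeg2 : ∀ u : Fin n, u.val < k → ((quasiStar n k j).neighborSet u).ncard ≤ b := by
    intro u hu
    have hsub : (quasiStar n k j).neighborSet u ⊆ (t : Set (Fin n)) := by
      intro v hv
      have := hadj u v hv hu
      simp [ht] at this ⊢
      exact this
    have := Set.ncard_le_ncard hsub (Set.toFinite _)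
    rwa [Set.ncard_coe_finset, htc] at this
  let f : Fin n → Fin n → ℕ := fun u v => if (quasiStar n k j).Adj u v then ((quasiStar n k j).neighborSet u).ncard * ((quasiStar n k j).neighborSet v).ncard else 0
  have e1 : ∑ u ∈ s, ∑ v ∈ s, f u v ≤ 0 := by
    refine le_of_eq (Finset.sum_eq_zero fun u hu => Finset.sum_eq_zero fun v hv => ?_)
    have hu' : u.val < k := by simpa [hs] using hu
    have hv' : v.val < k := by simpa [hs] using hv
    exact if_neg fun h => hadj u v h hu' hv'
  have e2 : ∑ u ∈ s, ∑ v ∈ t, f u v ≤ k * (b * (b * (n-1))) := by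
    calc _ ≤ ∑ u ∈ s, ∑ v ∈ t, b * (n-1) := by
          refine Finset.sum_le_sum fun u hu => Finset.sum_le_sum fun v hv => ?_
          have hu' : u.val < k := by simpa [hs] using hu
          simp only [f]
          split_ifs
          · exact Nat.mul_le_mul (hdeg2 u hu') (hdeg1 v)
          · exact Nat.zero_le _
      _ = _ := by simp [hsc, htc]
  have e3 : ∑ u ∈ t, ∑ v ∈ s, f u v ≤ b * (k * (b * (n-1))) := by
    calc _ ≤ ∑ u ∈ t, ∑ v ∈ s, b * (n-1) := by
          refine Finset.sum_le_sum fun u hu => Finset.sum_le_sum fun v hv => ?_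
          have hv' : v.val < k := by simpa [hs] using hv
          simp only [f]
          split_ifs
          · rw [mul_comm]
            exact Nat.mul_le_mul (hdeg2 v hv') (hdeg1 u)
          · exact Nat.zero_le _
      _ = _ := by simp [hsc, htc]
  have e4 : ∑ u ∈ t, ∑ v ∈ t, f u v ≤ b * ((b-1) * ((n-1) * (n-1))) := by
    calc _ ≤ ∑ u ∈ t, ((b-1) * ((n-1) * (n-1))) := by
          refine Finset.sum_le_sum fun u hu => ?_
          have hz : f u u = 0 := by simp [f]
          rw [← Finset.add_sum_erase t _ hu, hz, zero_add]
          calc _ ≤ ∑ v ∈ t.erase u, ((n-1) * (n-1)) := by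
                refine Finset.sum_le_sum fun v hv => ?_
                simp only [f]
                split_ifs
                · exact Nat.mul_le_mul (hdeg1 u) (hdeg1 v)
                · exact Nat.zero_le _
            _ = _ := by simp [Finset.card_erase_of_mem hu, htc]
      _ = _ := by simp [htc]
  have htot : ∑ u : Fin n, ∑ v : Fin n, f u v = (∑ u ∈ s, ∑ v ∈ s, f u v + ∑ u ∈ s, ∑ v ∈ t, f u v) + (∑ u ∈ t, ∑ v ∈ s, f u v + ∑ u ∈ t, ∑ v ∈ t, f u v) := by
    have hsp : ∀ g : Fin n → ℕ, ∑ v, g v = ∑ v ∈ s, g v + ∑ v ∈ t, g v := fun g =>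
      (Finset.sum_filter_add_sum_filter_not _ _ _).symm
    rw [hsp]
    simp only [hsp, Finset.sum_add_distrib]
    try ring
  have hM : 2 * M2 (quasiStar n k j) ≤ ∑ u : Fin n, ∑ v : Fin n, f u v := by
    have : M2 (quasiStar n k j) = (∑ u : Fin n, ∑ v : Fin n, f u v) / 2 := by
      unfold M2
      congr 1
    omega
  have h3 : 2 * M2 (quasiStar n k j) ≤ k * (b * (b * (n-1))) + (b * (k * (b * (n-1))) + b * ((b-1) * ((n-1) * (n-1)))) := by omega
  have h4 := (Nat.cast_le (α := ℝ)).2 h3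
  push_cast [Nat.cast_sub hb, Nat.cast_sub (show 1 ≤ n by omega)] at h4
  nlinarith

lemma root_bound (x n s : ℝ) (hs : s^2 = 2) (hs0 : 1.414 ≤ s) (hn : 8 ≤ n) (hx : 0 ≤ x)
    (h : n*(n-1)/2 - n + 2 ≤ x*(x+1)) : s*n/2 - 1.57 ≤ x := by
  by_contra hc
  push Not at hc
  have h1 : x*(x+1) ≤ (s*n/2 - 1.57)*((s*n/2 - 1.57)+1) :=
    mul_le_mul hc.le (by linarith) (by linarith) (by linarith)
  have h2 : (s*n/2 - 1.57)*((s*n/2 - 1.57)+1) = n^2/2 - 1.07*(s*n) + 0.8949 := by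
    linear_combination n^2/4 * hs
  have h3 : 1.414 * n ≤ s * n := mul_le_mul_of_nonneg_right hs0 (by linarith)
  rw [h2] at h1
  linarith

lemma F_mono (x y : ℝ) (hy : 4 ≤ y) (hxy : y ≤ x) :
    y*(y-1)*(y-1)^2/2 - (y+1)*y*(y-1) ≤ x*(x-1)*(x-1)^2/2 - (x+1)*x*(x-1) := by
  obtain ⟨a, ha, rfl⟩ : ∃ a : ℝ, 0 ≤ a ∧ y = 4 + a := ⟨y-4, by linarith, by ring⟩
  obtain ⟨c, hc, rfl⟩ : ∃ c : ℝ, 0 ≤ c ∧ x = 4 + a + c := ⟨x-(4+a), by linarith, by ring⟩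
  rw [← sub_nonneg]
  ring_nf
  positivity

lemma G_mono (n b c : ℝ) (hn : 8 ≤ n) (hb : 1 ≤ b) (hbc : b ≤ c) (hc : 2 * c ≤ n) :
    b*(b-1)*(n-1)^2/2 + (n-b)*b*(b*(n-1)) ≤ c*(c-1)*(n-1)^2/2 + (n-c)*c*(c*(n-1)) := by
  have h1 : b*(b-1) ≤ c*(c-1) := by nlinarith
  have h2 : (n-b)*b*b ≤ (n-c)*c*c := by
    have : 0 ≤ (c-b)*((c+b)*n-(c^2+c*b+b^2)) := by
      apply mul_nonneg (by linarith)
      nlinarith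
    nlinarith
  have h3 := mul_le_mul_of_nonneg_right h1 (sq_nonneg (n-1))
  have h4 := mul_le_mul_of_nonneg_right h2 (show 0 ≤ n-1 by linarith)
  nlinarith

lemma final_ineq (n s : ℝ) (hs : s^2 = 2) (hs0 : 1.414 ≤ s) (hs1 : s ≤ 1.415) (hn : 8 ≤ n) :
    (1/8) * ((3 - 2*s)*n^4 - (20 + 37*s)*n^3 + (19 + 76*s)*n^2 - (46 + 226*s)*n + 72) ≤
    (let y := s*n/2 - 1.57; y*(y-1)*(y-1)^2/2 - 1 - (y+1)*y*(y-1)) -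
    (let c := n - (s*n/2 - 1.57); c*(c-1)*(n-1)^2/2 + (n-c)*c*(c*(n-1))) := by
  have hs3 : s^3 = 2*s := by rw [pow_succ, hs]
  have hs4 : s^4 = 4 := by rw [show s^4 = (s^2)^2 by ring, hs]; norm_num
  obtain ⟨x, hx, rfl⟩ : ∃ x : ℝ, 0 ≤ x ∧ n = 8 + x := ⟨n-8, by linarith, by ring⟩
  rw [← sub_nonneg]
  ring_nf
  rw [hs4, hs3, hs]
  ring_nf
  have g1 := mul_le_mul_of_nonneg_right hs1 hx
  have g2 := mul_le_mul_of_nonneg_right hs1 (pow_nonneg hx 2)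
  have g3 := mul_le_mul_of_nonneg_right hs0 (pow_nonneg hx 3)
  have p2 := pow_nonneg hx 2
  have p3 := pow_nonneg hx 3
  linarith

theorem stmt14 (n m k j k' j' : ℕ) (hn : 8 ≤ n)
    (hm1 : ((n.choose 2 : ℕ) : ℚ)/2 - (n:ℚ)/2 ≤ (m:ℚ))
    (hm2 : (m:ℚ) ≤ ((n.choose 2 : ℕ) : ℚ)/2 + (n:ℚ)/2)
    (hj : 1 ≤ j) (hjk : j ≤ k) (hkj : m + j = (k+1).choose 2)
    (hj' : 1 ≤ j') (hjk' : j' ≤ k') (hkj' : m + (k'+1).choose 2 = n.choose 2 + j') :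
    pPoly (n:ℝ) ≤ ((Hval (quasiComplete n k j) : ℝ) - (Hval (quasiStar n k' j') : ℝ)) := by
  have hc1 : ((n.choose 2 : ℕ) : ℝ) = n * (n-1) / 2 := Nat.cast_choose_two ℝ n
  have hc2 : (((k+1).choose 2 : ℕ) : ℝ) = (k+1) * k / 2 := by
    rw [Nat.cast_choose_two]; push_cast; ring
  have hc3 : (((k'+1).choose 2 : ℕ) : ℝ) = (k'+1) * k' / 2 := by
    rw [Nat.cast_choose_two]; push_cast; ring
  have hm1' : ((n.choose 2 : ℕ) : ℝ)/2 - (n:ℝ)/2 ≤ (m:ℝ) := by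
    have := (Rat.cast_le (K := ℝ)).2 hm1
    push_cast at this
    exact this
  have hm2' : (m:ℝ) ≤ ((n.choose 2 : ℕ) : ℝ)/2 + (n:ℝ)/2 := by
    have := (Rat.cast_le (K := ℝ)).2 hm2
    push_cast at this
    exact this
  have hkj1 : (m:ℝ) + j = (((k+1).choose 2 : ℕ) : ℝ) := by exact_mod_cast hkj
  have hkj2 : (m:ℝ) + (((k'+1).choose 2 : ℕ) : ℝ) = ((n.choose 2 : ℕ) : ℝ) + j' := by exact_mod_cast hkj'
  rw [hc1] at hm1' hm2' hkj2
  rw [hc2] at hkj1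
  rw [hc3] at hkj2
  have hnR : (8:ℝ) ≤ n := by exact_mod_cast hn
  have hjR : (1:ℝ) ≤ j := by exact_mod_cast hj
  have hjR' : (1:ℝ) ≤ j' := by exact_mod_cast hj'
  have hjkR : (j:ℝ) ≤ k := by exact_mod_cast hjk
  have hjkR' : (j':ℝ) ≤ k' := by exact_mod_cast hjk'
  have hkn : k < n := by
    by_contra h
    have h' : (n:ℝ) ≤ k := by exact_mod_cast not_lt.1 h
    have h1 : (n:ℝ) * (n-1) ≤ k * (k-1) := mul_le_mul h' (by linarith) (by linarith) (by linarith)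
    have h2 : 8 * (n:ℝ) ≤ n * n := mul_le_mul_of_nonneg_right hnR (by linarith)
    linarith
  have hkn' : k' < n := by
    by_contra h
    have h' : (n:ℝ) ≤ k' := by exact_mod_cast not_lt.1 h
    have h1 : (n:ℝ) * (n-1) ≤ k' * (k'-1) := mul_le_mul h' (by linarith) (by linarith) (by linarith)
    have h2 : 8 * (n:ℝ) ≤ n * n := mul_le_mul_of_nonneg_right hnR (by linarith)
    linarith
  have hs : (Real.sqrt 2)^2 = 2 := Real.sq_sqrt (by norm_num)
  have hs0 : 1.414 ≤ Real.sqrt 2 := Real.le_sqrt_of_sq_le (by norm_num)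
  have hs1 : Real.sqrt 2 ≤ 1.415 := Real.sqrt_le_iff.2 (by norm_num)
  have hq0 : 1.414 * (n:ℝ) ≤ Real.sqrt 2 * n := mul_le_mul_of_nonneg_right hs0 (by linarith)
  have r1 := root_bound k n _ hs hs0 hnR (Nat.cast_nonneg _) (by linarith)
  have r2 := root_bound k' n _ hs hs0 hnR (Nat.cast_nonneg _) (by linarith)
  obtain ⟨b, hb⟩ : ∃ b, k' + b = n := ⟨n - k', by omega⟩
  have hb1 : 1 ≤ b := by omega
  have hbR : (k':ℝ) + b = n := by exact_mod_cast hb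
  have hbR1 : (1:ℝ) ≤ b := by exact_mod_cast hb1
  have a1 := M2_qc n k j hkn
  have a2 := k3_qc n k j hkn
  have a3 := M2_qs n k' b j' hb hb1
  have a4 : (0:ℝ) ≤ (k3 (quasiStar n k' j') : ℝ) := Nat.cast_nonneg _
  have f1 := F_mono k (Real.sqrt 2 * n/2 - 1.57) (by linarith) r1
  have f2 := G_mono n b (n - (Real.sqrt 2 * n/2 - 1.57)) hnR hbR1 (by linarith) (by linarith)
  have f3 := final_ineq n _ hs hs0 hs1 hnR
  have hk'e : (k':ℝ) = n - b := by linarith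
  rw [hk'e] at a3
  simp only at f3
  unfold pPoly Hval
  push_cast
  clear hm1 hm2 hm1' hm2' hkj1 hkj2 r1 r2 hs hs0 hs1 hq0 hc1 hc2 hc3 hjR hjR' hjkR hjkR' hk'e
  refine f3.trans ?_
  clear f3
  linarith
end

section
/- Let n and m be integers with n ≥ 437, (1/2)C(n,2) − n/2 ≤ m ≤ (1/2)C(n,2) + n/2, and M₁(S¹_{n,m}) = M₁(C¹_{n,m}). Let k, j be the unique integers with 1 ≤ j ≤ k and m = C(k+1,2) − j. If j = 3 (so that C³_{n,m} exists), then C³_{n,m} is H-optimal in 𝒢_{n,m} and every H-optimal graph in 𝒢_{n,m} is isomorphic to C³_{n,m}; if j ≠ 3, then C¹_{n,m} is H-optimal in 𝒢_{n,m} and every H-optimal graph in 𝒢_{n,m} is isomorphic to C¹_{n,m}. -/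
namespace ZG

/-- value of the quasi-complete graph -/
def CV (a t : ℤ) : ℤ := a*(a-1)^2 + 2*a*t + t*(t-1)

theorem exists_row (q : ℕ) : ∃ p : ℕ × ℕ, p.2 < p.1 ∧ 2*q + p.1 = p.1*p.1 + 2*p.2 := by
  induction q with
  | zero => exact ⟨(1,0), by norm_num, by norm_num⟩
  | succ q ih =>
    obtain ⟨⟨a,t⟩, h1, h2⟩ := ih
    simp only at h1 h2
    by_cases h : t + 1 < a
    · exact ⟨(a,t+1), h, by simp only; omega⟩
    · refine ⟨(a+1,0), by simp, ?_⟩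
      have : a = t+1 := by omega
      subst this
      simp only
      nlinarith

noncomputable def row (q : ℕ) : ℕ := (exists_row q).choose.1
noncomputable def pos (q : ℕ) : ℕ := (exists_row q).choose.2
theorem pos_lt (q : ℕ) : pos q < row q := (exists_row q).choose_spec.1
theorem row_eq (q : ℕ) : 2*q + row q = row q * row q + 2 * pos q := (exists_row q).choose_spec.2

noncomputable def Cf (q : ℕ) : ℤ := CV (row q) (pos q)

theorem row_le {a t b s : ℕ} (hs : s < b) (hle : a*a + 2*t + b ≤ b*b+2*s + a) : a ≤ b := by
  by_contra h
  push Not at h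
  obtain ⟨c, rfl⟩ := Nat.exists_eq_add_of_lt h
  nlinarith

theorem rep_unique {a t q : ℕ} (h : t < a) (hq : 2*q + a = a*a + 2*t) : row q = a ∧ pos q = t := by
  have h1 := row_eq q
  have h2 := pos_lt q
  have e1 : a ≤ row q := row_le (t := t) h2 (by omega)
  have e2 : row q ≤ a := row_le (t := pos q) h (by omega)
  have e : row q = a := le_antisymm e2 e1
  rw [e] at h1
  exact ⟨e, by omega⟩

theorem Cf_eq {a t q : ℕ} (h : t ≤ a) (hq : 2*q + a = a*a + 2*t) : Cf q = CV a t := by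
  rcases h.lt_or_eq with h | h
  · obtain ⟨e1, e2⟩ := rep_unique h hq
    rw [Cf, e1, e2]
  · subst h
    obtain ⟨e1, e2⟩ := rep_unique (a := t+1) (t := 0) (q := q) (by omega) (by nlinarith)
    rw [Cf, e1, e2]; simp only [CV]; push_cast; ring

theorem Cf_succ {a t q : ℕ} (h : t < a) (hq : 2*q + a = a*a + 2*t) :
    Cf (q+1) = Cf q + 2*(a+t) := by
  rw [Cf_eq h.le hq, Cf_eq (a := a) (t := t+1) (by omega) (by omega)]
  simp only [CV]; push_cast; ring

theorem Cf_zero : Cf 0 = 0 := by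
  rw [Cf_eq (a := 1) (t := 0) (by omega) (by omega)]; simp [CV]

theorem Cf_le_star (q : ℕ) : Cf q ≤ q^2 + q := by
  induction q with
  | zero => simp [Cf_zero]
  | succ q ih =>
    have h1 := row_eq q
    have h2 := pos_lt q
    rw [Cf_succ h2 h1]
    push_cast
    zify at h1
    nlinarith [mul_self_nonneg ((row q : ℤ) - 1), mul_self_nonneg ((row q : ℤ) - 2), (by
      rcases Nat.lt_or_ge (row q) 2 with h | h
      · have : row q = 1 := by omega
        rw [this]; norm_num
      · have : (0:ℤ) ≤ (row q : ℤ) - 2 := by omega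
        nlinarith : (0:ℤ) ≤ ((row q : ℤ) - 1) * ((row q : ℤ) - 2))]

theorem Cf_lt_star (q : ℕ) (hq : 4 ≤ q) : Cf q < q^2 + q := by
  obtain ⟨q, rfl⟩ : ∃ r, q = r + 1 := ⟨q-1, by omega⟩
  have h1 := row_eq q
  have h2 := pos_lt q
  rw [Cf_succ h2 h1]
  have := Cf_le_star q
  have h3 : 3 ≤ row q := by
    by_contra h
    have : row q ≤ 2 := by omega
    have : row q * row q ≤ 4 := by nlinarith
    omega
  push_cast
  zify at h1 h3
  nlinarith

noncomputable def D (q n : ℕ) : ℤ := Cf (q+n) - Cf q - 4*q - n^2 - n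

theorem D1 {a t q n : ℕ} (h : t < a) (hq : 2*q + a = a*a + 2*t) (h1 : a ≤ n + t)
    (h2 : n + t ≤ 2*a+1) : D q n = 2*t*(n-a-1) := by
  obtain ⟨p, hp⟩ := Nat.exists_eq_add_of_le h1
  rw [D, Cf_eq h.le hq, Cf_eq (a := a+1) (t := p) (by omega) (by nlinarith)]
  have hn : (n:ℤ) = a + p - t := by omega
  zify at hq
  have h4 : 4*(q:ℤ) = 2*(a*a + 2*t - a) := by linarith
  simp only [CV]; push_cast; rw [h4, hn]; ring

theorem D2 {a t q n : ℕ} (h : t < a) (hq : 2*q + a = a*a + 2*t) (h1 : 2*a+1 ≤ n + t)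
    (h2 : n + t ≤ 3*a+3) : D q n = 2*(a-t)*(2*a+1-n) := by
  obtain ⟨p, hp⟩ := Nat.exists_eq_add_of_le h1
  rw [D, Cf_eq h.le hq, Cf_eq (a := a+2) (t := p) (by omega) (by nlinarith)]
  have hn : (n:ℤ) = 2*a + 1 + p - t := by omega
  zify at hq
  have h4 : 4*(q:ℤ) = 2*(a*a + 2*t - a) := by linarith
  simp only [CV]; push_cast; rw [h4, hn]; ring

theorem D3 {a t q : ℕ} (h : t < a) (hq : 2*q + a = a*a + 2*t) (i : ℕ) :
    D q (2*a+1+i) ≤ -i := by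
  induction i with
  | zero => rw [D2 h hq (by omega) (by omega)]; push_cast; ring_nf; simp
  | succ i ih =>
    have h1 := row_eq (q + (2*a+1+i))
    have h2 := pos_lt (q + (2*a+1+i))
    have h3 := Cf_succ h2 h1
    rw [D] at ih ⊢
    rw [show q + (2*a+1+(i+1)) = q + (2*a+1+i) + 1 by ring, h3]
    have h4 : a + 2 ≤ row (q + (2*a+1+i)) := row_le (t := t + i) h2 (by nlinarith)
    obtain ⟨c, hc⟩ := Nat.exists_eq_add_of_le h4
    rw [hc] at h1 ⊢
    push_cast at ih ⊢
    zify at h1 hq h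
    nlinarith

theorem D_neg {a t q n : ℕ} (h : t < a) (hq : 2*q + a = a*a + 2*t) (hn : 2*a+1 < n) : D q n < 0 := by
  obtain ⟨i, rfl⟩ := Nat.exists_eq_add_of_le hn.le
  have := D3 h hq i
  have : 0 < i := by omega
  omega

noncomputable def Sv (n m q : ℕ) : ℤ := Cf q + 4*m*(n-1) - n*(n-1)^2

theorem Sv_succ {n m q : ℕ} (hb : 2*(m+q)+n = n*n) : Sv (n+1) m (q+n) = Sv n m q + D q n := by
  simp only [Sv, D]
  zify at hb
  push_cast
  have : (m:ℤ)*4 = 2*(n*n-n) - 4*q := by linarith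
  linear_combination (this)

theorem Sv_star {n m q : ℕ} (hb : 2*(m+q)+n = n*n) (hm : m + 1 ≤ n) : Sv n m q = m^2+m := by
  obtain ⟨p, hp⟩ := Nat.exists_eq_add_of_le hm
  subst hp
  rw [Sv, Cf_eq (a := m+p) (t := p) (by omega) (by nlinarith)]
  simp only [CV]; push_cast; ring

theorem Sv_compl {n m q : ℕ} (hb : 2*(m+q)+n = n*n) : Sv n m q = Cf q + n*(n-1)^2 - 4*q*(n-1) := by
  rw [Sv]
  zify at hb
  linear_combination (2*(n:ℤ)-2)*hb

theorem row_le_n {n m q a t : ℕ} (hb : 2*(m+q)+n = n*n) (hq : 2*q + a = a*a + 2*t) (hn : 1 ≤ n) :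
    a ≤ n ∧ (t = 0 ∨ a + 1 ≤ n) := by
  have : a ≤ n := by
    by_contra h
    push Not at h
    obtain ⟨c, rfl⟩ := Nat.exists_eq_add_of_lt h
    nlinarith
  refine ⟨this, ?_⟩
  by_contra h
  push Not at h
  have : a = n := by omega
  subst this
  omega

theorem A0 (n : ℕ) : ∀ (m q a t : ℕ), 2*(m+q)+n = n*n → t < a → 2*q + a = a*a + 2*t → 2*a+1 < n →
    Sv n m q ≤ Cf m := by
  induction n with
  | zero => intros; omega
  | succ n ih =>
    intro m q a t hb h hq hn
    by_cases hqn : n ≤ q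
    · obtain ⟨q0, rfl⟩ := Nat.exists_eq_add_of_le hqn
      have hb0 : 2*(m+q0)+n = n*n := by nlinarith
      have h1 := row_eq q0
      have h2 := pos_lt q0
      have h3 := (row_le_n hb0 h1 (by omega)).1
      have h4 : row q0 + 1 ≤ a := by
        obtain ⟨c, hc⟩ := Nat.exists_eq_add_of_le h3
        exact row_le (t := pos q0 + c) h (by nlinarith)
      have h5 := ih m q0 _ _ hb0 h2 h1 (by omega)
      have h6 := D_neg (n := n) h2 h1 (by omega)
      rw [add_comm n q0, Sv_succ hb0]
      linarith
    · push Not at hqn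
      have e := Sv_star (n := n+1) (m := q) (q := m) (by omega) (by omega)
      rw [Sv_compl (by omega)] at e
      have := Cf_le_star q
      rw [Sv]
      push_cast at *
      linarith

theorem claimA {n m q : ℕ} (hb : 2*(m+q)+n = n*n) : Sv n m q ≤ max (Cf m) (Sv (n+1) m (q+n)) := by
  have h1 := row_eq q
  have h2 := pos_lt q
  by_cases h : 2*row q + 1 < n
  · exact le_max_of_le_left (A0 n m q _ _ hb h2 h1 h)
  · apply le_max_of_le_right
    rw [Sv_succ hb]
    suffices 0 ≤ D q n by linarith
    rcases Nat.eq_zero_or_pos n with h0 | h0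
    · subst h0; simp at hb; simp [D, hb]
    obtain ⟨r1, r2⟩ := row_le_n hb h1 h0
    push Not at h
    rcases Nat.le_total (n + pos q) (2*row q+1) with h3 | h3
    · rw [D1 h2 h1 (by omega) h3]
      rcases r2 with r2 | r2
      · simp [r2]
      · have : (0:ℤ) ≤ n - row q - 1 := by omega
        positivity
    · rw [D2 h2 h1 h3 (by omega)]
      have e1 : (0:ℤ) ≤ row q - pos q := by omega
      have e2 : (0:ℤ) ≤ 2*row q + 1 - n := by omega
      positivity

theorem lemL {n m q a t : ℕ} (hb : 2*(m+q)+n = n*n) (h : t < a) (hm : 2*m + a = a*a + 2*t)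
    (hn : 2*a+1 ≤ n) (hmn : n ≤ m) : Cf m < Sv n m q := by
  obtain ⟨N, rfl⟩ : ∃ N, n = N+1 := ⟨n-1, by omega⟩
  obtain ⟨r, rfl⟩ := Nat.exists_eq_add_of_le (show N ≤ m by omega)
  have h1 := row_eq r
  have h2 := pos_lt r
  have hb0 : 2*(q+r)+N = N*N := by nlinarith
  have h3 : row r + 2 ≤ a := by
    obtain ⟨c, hc⟩ := Nat.exists_eq_add_of_le (show 2*a ≤ N by omega)
    by_contra hcon
    obtain ⟨d, hd⟩ := Nat.exists_eq_add_of_le (show a ≤ row r + 1 by omega)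
    have g1 : (row r : ℤ) = a + d - 1 := by omega
    have g2 : d ≤ d * d := Nat.le_mul_self d
    have g3 : 0 ≤ (d:ℤ) * (a-1) := mul_nonneg (by omega) (by omega)
    zify at h1 hm hc g2
    rw [g1] at h1
    have g4 : (N:ℤ) = 2*a+c := hc
    have g5 : (t:ℤ) + 1 ≤ a := by omega
    nlinarith only [h1, hm, g2, g3, g4, g5, Int.natCast_nonneg c, Int.natCast_nonneg (pos r)]
  have e1 := A0 N q r _ _ hb0 h2 h1 (by omega)
  have e2 := D_neg (n := N) h2 h1 (by omega)
  have e3 := Sv_succ hb0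
  rw [Sv_compl (by nlinarith)]
  rw [add_comm r N, Sv] at e3
  push_cast at *
  have e4 : Sv N q r + D r N < Cf q := by linarith
  rw [← e3] at e4
  zify at hb
  nlinarith

end ZG

namespace ZG

def E (b : ℕ → Bool) : ℕ → ℕ
  | 0 => 0
  | n+1 => if b n then E b n + n else E b n

def Z (b : ℕ → Bool) : ℕ → ℤ
  | 0 => 0
  | n+1 => if b n then Z b n + 4 * E b n + n + n^2 else Z b n

def nb (b : ℕ → Bool) : ℕ → Bool := fun v => !b v

theorem nb_nb (b : ℕ → Bool) : nb (nb b) = b := by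
  funext v; simp [nb]

theorem E_f {b : ℕ → Bool} {n : ℕ} (h : b n = false) : E b (n+1) = E b n := by simp [E, h]
theorem E_t {b : ℕ → Bool} {n : ℕ} (h : b n = true) : E b (n+1) = E b n + n := by simp [E, h]
theorem Z_f {b : ℕ → Bool} {n : ℕ} (h : b n = false) : Z b (n+1) = Z b n := by simp [Z, h]
theorem Z_t {b : ℕ → Bool} {n : ℕ} (h : b n = true) :
    Z b (n+1) = Z b n + 4 * E b n + n + n^2 := by simp [Z, h]
theorem nb_f {b : ℕ → Bool} {n : ℕ} (h : b n = false) : nb b n = true := by simp [nb, h]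
theorem nb_t {b : ℕ → Bool} {n : ℕ} (h : b n = true) : nb b n = false := by simp [nb, h]

theorem bal (b : ℕ → Bool) (n : ℕ) : 2*(E b n + E (nb b) n) + n = n*n := by
  induction n with
  | zero => simp [E]
  | succ n ih =>
    cases h : b n
    · rw [E_f h, E_t (nb_f h)]; nlinarith
    · rw [E_t h, E_f (nb_t h)]; nlinarith

theorem Z_nb (b : ℕ → Bool) (n : ℕ) :
    Z (nb b) n = Z b n - 4 * E b n * (n-1) + n*(n-1)^2 := by
  induction n with
  | zero => simp [E, Z]
  | succ n ih =>
    have hb := bal b n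
    zify at hb
    cases h : b n
    · rw [E_f h, Z_t (nb_f h), Z_f h, ih]
      push_cast
      linear_combination 2 * hb
    · rw [E_t h, Z_f (nb_t h), Z_t h, ih]
      push_cast
      ring

noncomputable def mx (b : ℕ → Bool) (n : ℕ) : ℤ := max (Cf (E b n)) (Sv n (E b n) (E (nb b) n))

theorem Sv_nb (b : ℕ → Bool) (n : ℕ) :
    Sv n (E (nb b) n) (E b n) = Cf (E b n) - 4 * E b n * (n-1) + n*(n-1)^2 := by
  have := bal b n
  rw [Sv_compl (by omega)]; ring

theorem mx_nb (b : ℕ → Bool) (n : ℕ) :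
    mx (nb b) n = mx b n - 4 * E b n * (n-1) + n*(n-1)^2 := by
  rw [mx, mx, nb_nb, Sv_nb, max_comm]
  have : Cf (E (nb b) n) = Sv n (E b n) (E (nb b) n) - 4 * E b n * (n-1) + n*(n-1)^2 := by
    rw [Sv]; ring
  rw [this, sub_add, sub_add, max_sub_sub_right]; ring

theorem mx_f {b : ℕ → Bool} {n : ℕ} (h : b n = false) : mx b n ≤ mx b (n+1) := by
  rw [mx, mx, E_f h, E_t (nb_f h)]
  exact max_le (le_max_left _ _) (claimA (bal b n))

theorem AK (n : ℕ) : ∀ b, Z b n ≤ mx b n := by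
  induction n with
  | zero => intro b; simp [Z, mx, E, Cf_zero]
  | succ n ih =>
    have key : ∀ b : ℕ → Bool, b n = false → Z b (n+1) ≤ mx b (n+1) := by
      intro b h
      rw [Z_f h]
      exact (ih b).trans (mx_f h)
    intro b
    cases h : b n
    · exact key b h
    · have := key (nb b) (nb_t h)
      rw [Z_nb, mx_nb] at this
      linarith

def Opt (b : ℕ → Bool) (n : ℕ) : Prop := mx b n ≤ Z b n

theorem Opt_nb {b : ℕ → Bool} {n : ℕ} (h : Opt b n) : Opt (nb b) n := by
  unfold Opt at *
  rw [Z_nb, mx_nb]; linarith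

def F1 (n a t : ℕ) (b : ℕ → Bool) : Prop :=
  (t = 0 ∨ a + 1 ≤ n) ∧ (a ≤ n ∨ n = 0) ∧ ∀ v, 1 ≤ v → v < n → (b v = true ↔ v ≤ a ∧ v ≠ a - t)
def F2 (n a t : ℕ) (b : ℕ → Bool) : Prop :=
  a + t ≤ n ∧ ∀ v, 1 ≤ v → v < n → (b v = true ↔ v + 1 < a ∨ v + 1 = a + t)
def F3 (n a t : ℕ) (b : ℕ → Bool) : Prop :=
  t + 3 = a ∧ a + 1 ≤ n ∧ ∀ v, 1 ≤ v → v < n → (b v = true ↔ 3 ≤ v ∧ v ≤ a)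

def CF (n : ℕ) (b : ℕ → Bool) : Prop :=
  Z b n = Cf (E b n) ∧ ∃ a t, t < a ∧ 2 * E b n + a = a * a + 2 * t ∧
    (F1 n a t b ∨ F2 n a t b ∨ F3 n a t b)

theorem F2_F1 {n a t : ℕ} {b : ℕ → Bool} (ht : t < a) (h1 : t ≤ 1) (h : F2 n a t b) : F1 n a t b := by
  obtain ⟨h2, h3⟩ := h
  refine ⟨by omega, by omega, fun v hv hv' => ?_⟩
  rw [h3 v hv hv']
  omega

theorem CF_f {n : ℕ} {b : ℕ → Bool} (h : CF n b) (hf : b n = false) : CF (n+1) b := by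
  obtain ⟨hZ, a, t, ht, he, hF⟩ := h
  refine ⟨by rw [Z_f hf, E_f hf, hZ], a, t, ht, by rw [E_f hf, he], ?_⟩
  rcases hF with ⟨h1, h2, h3⟩ | ⟨h1, h2⟩ | ⟨h1, h2, h3⟩
  · rcases Nat.eq_zero_or_pos n with h0 | h0
    · subst h0
      simp [E] at he
      have : t = 0 := by omega
      subst this
      have : a = 1 := by nlinarith
      subst this
      exact Or.inl ⟨by omega, by omega, fun v hv hv' => by omega⟩
    refine Or.inl ⟨by omega, by omega, fun v hv hv' => ?_⟩
    rcases Nat.lt_or_ge v n with h4 | h4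
    · exact h3 v hv h4
    · have : v = n := by omega
      subst this
      simp [hf]; omega
  · refine Or.inr (Or.inl ⟨by omega, fun v hv hv' => ?_⟩)
    rcases Nat.lt_or_ge v n with h4 | h4
    · exact h2 v hv h4
    · have : v = n := by omega
      subst this
      simp [hf]; omega
  · refine Or.inr (Or.inr ⟨h1, by omega, fun v hv hv' => ?_⟩)
    rcases Nat.lt_or_ge v n with h4 | h4
    · exact h3 v hv h4
    · have : v = n := by omega
      subst this
      simp [hf]; omega

/-- the star region: few edges -/
theorem CF_star {n : ℕ} {b : ℕ → Bool} (hc : CF n (nb b)) (ho : Opt b n)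
    (hq : E (nb b) n + 1 ≤ n) : CF n b := by
  obtain ⟨hZ, a, t, ht, he, hF⟩ := hc
  have hb := bal b n
  have ho' := Opt_nb ho
  unfold Opt at ho'
  have h1 : Sv n (E (nb b) n) (E b n) ≤ Z (nb b) n := by
    refine le_trans ?_ ho'
    rw [mx, nb_nb]; exact le_max_right _ _
  have h2 := Sv_star (n := n) (m := E (nb b) n) (q := E b n) (by omega) hq
  have h3 := Cf_le_star (E (nb b) n)
  have h4 : E (nb b) n ≤ 3 := by
    by_contra hcon
    have := Cf_lt_star (E (nb b) n) (by omega)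
    rw [h2, hZ] at h1
    linarith
  have hZb : Z b n = Cf (E b n) := by
    have e1 := Sv_nb b n
    have e2 := Z_nb b n
    have e3 : Z (nb b) n = Sv n (E (nb b) n) (E b n) := by linarith
    linarith
  refine ⟨hZb, ?_⟩
  have hnb : ∀ v, (b v = true ↔ ¬ (nb b v = true)) := by intro v; simp [nb]
  have ha : a ≤ 3 := by
    by_contra hcon
    nlinarith
  obtain ⟨k, rfl⟩ : ∃ k, n = k + 1 := ⟨n-1, by omega⟩
  have hb' : 2 * (E b (k+1)) + 2 * E (nb b) (k+1) = k*k + k := by nlinarith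
  rcases Nat.eq_zero_or_pos (E (nb b) (k+1)) with h0 | h0
  · refine ⟨k+1, 0, by omega, by rw [h0] at hb'; nlinarith, Or.inl ⟨by omega, by omega, ?_⟩⟩
    intro v hv hv'
    rw [hnb]
    rw [h0] at he
    have : a = 1 ∧ t = 0 := by interval_cases a <;> omega
    obtain ⟨rfl, rfl⟩ := this
    rcases hF with ⟨_, _, h3⟩ | ⟨_, h3⟩ | ⟨h3, _⟩
    · rw [h3 v hv hv']; omega
    · rw [h3 v hv hv']; omega
    · omega
  · refine ⟨k, k - E (nb b) (k+1), by omega, ?_, ?_⟩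
    · have : E (nb b) (k+1) ≤ k := by omega
      omega
    · have hcases : (a = 2 ∧ t = 0 ∧ E (nb b) (k+1) = 1) ∨ (a = 2 ∧ t = 1 ∧ E (nb b) (k+1) = 2) ∨
          (a = 3 ∧ t = 0 ∧ E (nb b) (k+1) = 3) := by
        interval_cases a <;> omega
      have hF1 : ∀ j, E (nb b) (k+1) = j → (∀ v, 1 ≤ v → v < k+1 → (nb b v = true ↔ v = j)) →
          F1 (k+1) k (k - E (nb b) (k+1)) b := by
        intro j hj h
        refine ⟨by omega, by omega, fun v hv hv' => ?_⟩
        rw [hnb, h v hv hv', hj]; omega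
      rcases hcases with ⟨rfl, rfl, h5⟩ | ⟨rfl, rfl, h5⟩ | ⟨rfl, rfl, h5⟩
      · left
        apply hF1 1 h5
        intro v hv hv'
        rcases hF with ⟨_, _, h3⟩ | ⟨_, h3⟩ | ⟨h3, _⟩
        · rw [h3 v hv hv']; omega
        · rw [h3 v hv hv']; omega
        · omega
      · left
        apply hF1 2 h5
        intro v hv hv'
        rcases hF with ⟨_, _, h3⟩ | ⟨_, h3⟩ | ⟨h3, _⟩
        · rw [h3 v hv hv']; omega
        · rw [h3 v hv hv']; omega
        · omega
      · have hF3 : (∀ v, 1 ≤ v → v < k+1 → (nb b v = true ↔ v < 3)) →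
          F3 (k+1) k (k - E (nb b) (k+1)) b := by
          intro h
          refine ⟨by omega, by omega, fun v hv hv' => ?_⟩
          rw [hnb, h v hv hv']; omega
        rcases hF with ⟨_, _, h3⟩ | ⟨_, h3⟩ | ⟨_, _, h3⟩
        · right; right
          apply hF3
          intro v hv hv'
          rw [h3 v hv hv']; omega
        · right; right
          apply hF3
          intro v hv hv'
          rw [h3 v hv hv']; omega
        · left
          apply hF1 3 h5
          intro v hv hv'
          rw [h3 v hv hv']; omega

/-- adding a dominating vertex -/
theorem CF_t {n : ℕ} {c : ℕ → Bool} (hc : CF n c) (ht : c n = true) (ho : Opt c n)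
    (hD : D (E c n) n ≤ 0) (hq : n ≤ E c n) : CF (n+1) c := by
  obtain ⟨hZ, a, t, hta, he, hF⟩ := hc
  have hb := bal c n
  rcases Nat.eq_zero_or_pos n with h0 | h0
  · subst h0
    simp [E] at he
    have : t = 0 := by have := Nat.le_mul_self a; omega
    subst this
    have : a = 1 := by nlinarith
    subst this
    refine ⟨by simp [Z, E, Cf_zero], 1, 0, by omega, by simp [E], Or.inl ⟨by omega, by omega, fun v hv hv' => by omega⟩⟩
  obtain ⟨r1, r2⟩ := row_le_n (m := E (nb c) n) (by omega) he h0
  have hn2 : n ≤ 2*a := by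
    by_contra hcon
    have := lemL hb hta he (by omega) hq
    unfold Opt at ho
    rw [hZ, mx] at ho
    exact absurd (le_trans (le_max_right _ _) ho) (not_le.mpr this)
  have hcase : D (E c n) n = 0 ∧ (t = 0 ∨ n = a+1) := by
    rcases Nat.le_total (n + t) (2*a+1) with h3 | h3
    · rw [D1 hta he (by omega) h3] at hD ⊢
      rcases r2 with r2 | r2
      · simp [r2]
      · rcases Nat.eq_zero_or_pos t with h | h
        · simp [h]
        · have : (n:ℤ) - a - 1 = 0 := by
            have e1 : (0:ℤ) ≤ n - a - 1 := by omega
            have e2 : (0:ℤ) < t := by omega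
            by_contra hne
            have e3 : (0:ℤ) < n - a - 1 := by omega
            have : 0 < 2 * (t:ℤ) * (n - a - 1) := by positivity
            omega
          rw [this]
          exact ⟨by ring, Or.inr (by omega)⟩
    · rw [D2 hta he h3 (by omega)] at hD
      have e1 : (0:ℤ) < a - t := by omega
      have e2 : (0:ℤ) < 2*a+1-n := by omega
      have : 0 < 2 * ((a:ℤ) - t) * (2*a+1-n) := by positivity
      omega
  obtain ⟨hD0, hcase⟩ := hcase
  refine ⟨?_, ?_⟩
  · rw [Z_t ht, E_t ht, hZ]
    rw [D] at hD0
    linarith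
  rw [E_t ht]
  by_cases hna : n = a+1
  · have hstep : ∀ {P : ℕ → Prop}, (∀ v, 1 ≤ v → v < n → (c v = true ↔ P v)) → P n →
      ∀ v, 1 ≤ v → v < n+1 → (c v = true ↔ P v) := by
      intro P h1 h2 v hv hv'
      rcases Nat.lt_or_ge v n with h4 | h4
      · exact h1 v hv h4
      · have : v = n := by omega
        subst this
        simp [ht, h2]
    refine ⟨a+1, t+1, by omega, by nlinarith, ?_⟩
    have hF' : F1 n a t c ∨ F3 n a t c := by
      rcases hF with h | h | h
      · exact Or.inl h
      · exact Or.inl (F2_F1 hta (by have := h.1; omega) h)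
      · exact Or.inr h
    rcases hF' with ⟨_, _, h3⟩ | ⟨h1, h2, h3⟩
    · left
      refine ⟨by omega, by omega, ?_⟩
      apply hstep
      · intro v hv hv'
        rw [h3 v hv hv']; omega
      · omega
    · right; right
      refine ⟨by omega, by omega, ?_⟩
      apply hstep
      · intro v hv hv'
        rw [h3 v hv hv']; omega
      · omega
  · have ht0 : t = 0 := by omega
    subst ht0
    obtain ⟨p, rfl⟩ := Nat.exists_eq_add_of_le r1
    refine ⟨a+1, p, by omega, by nlinarith, Or.inr (Or.inl ⟨by omega, ?_⟩)⟩
    intro v hv hv'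
    rcases Nat.lt_or_ge v (a+p) with h4 | h4
    · rcases hF with ⟨_, _, h3⟩ | ⟨_, h3⟩ | ⟨h3, h5, _⟩
      · rw [h3 v hv h4]; omega
      · rw [h3 v hv h4]; omega
      · have : a = 3 := by omega
        subst this
        omega
    · have : v = a+p := by omega
      subst this
      simp [ht]; omega

theorem classify (n : ℕ) : ∀ b, Opt b n → CF n b ∨ CF n (nb b) := by
  induction n with
  | zero =>
    intro b _
    exact Or.inl ⟨by simp [Z, E, Cf_zero], 1, 0, by omega, by simp [E],
      Or.inl ⟨by omega, by omega, fun v hv hv' => by omega⟩⟩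
  | succ n ih =>
    have key : ∀ b : ℕ → Bool, b n = false → Opt b (n+1) → CF (n+1) b ∨ CF (n+1) (nb b) := by
      intro b h ho
      have ho1 : Opt b n := by
        unfold Opt at *
        rw [Z_f h] at ho
        exact (mx_f h).trans ho
      rcases ih b ho1 with h1 | h1
      · exact Or.inl (CF_f h1 h)
      · rcases Nat.lt_or_ge (E (nb b) n) n with h2 | h2
        · exact Or.inl (CF_f (CF_star h1 ho1 h2) h)
        · right
          apply CF_t h1 (nb_f h) (Opt_nb ho1) _ h2
          have e1 := Sv_succ (bal b n)
          have e2 : Sv (n+1) (E b n) (E (nb b) n + n) ≤ Z b n := by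
            unfold Opt at ho
            rw [Z_f h, mx, E_f h, E_t (nb_f h)] at ho
            exact (le_max_right _ _).trans ho
          have e3 := Z_nb b n
          have e4 : Cf (E (nb b) n) = Sv n (E b n) (E (nb b) n) - 4 * E b n * (n-1) + n*(n-1)^2 := by
            rw [Sv]; ring
          have e5 := h1.1
          linarith
    intro b ho
    cases h : b n
    · exact key b h ho
    · have := key (nb b) (nb_t h) (Opt_nb ho)
      rw [nb_nb] at this
      exact this.symm

end ZG

namespace ZG
open Finset

def M2s (b : ℕ → Bool) : ℕ → ℤ
  | 0 => 0
  | n+1 => if b n then M2s b n + Z b n + E b n + n * (2 * E b n + n) else M2s b n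

def Ks (b : ℕ → Bool) : ℕ → ℕ
  | 0 => 0
  | n+1 => if b n then Ks b n + E b n else Ks b n

def adjB (b : ℕ → Bool) (u v : ℕ) : Prop := u ≠ v ∧ b (max u v) = true

instance (b : ℕ → Bool) : DecidableRel (adjB b) := fun _ _ => inferInstanceAs (Decidable (_ ∧ _))

theorem adjB_symm {b : ℕ → Bool} {u v : ℕ} (h : adjB b u v) : adjB b v u :=
  ⟨h.1.symm, by rw [max_comm]; exact h.2⟩

def TG (n : ℕ) (b : ℕ → Bool) : SimpleGraph (Fin n) where
  Adj u v := adjB b u v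
  symm := ⟨fun _ _ h => adjB_symm h⟩
  loopless := ⟨fun _ h => h.1 rfl⟩

def A (b : ℕ → Bool) (u v : ℕ) : ℤ := if adjB b u v then 1 else 0

theorem A_comm (b : ℕ → Bool) (u v : ℕ) : A b u v = A b v u := by
  simp only [A]
  congr 1
  exact propext ⟨adjB_symm, adjB_symm⟩

theorem A_lt {b : ℕ → Bool} {u n : ℕ} (h : u < n) : A b u n = if b n then 1 else 0 := by
  simp [A, adjB, h.ne, max_eq_right h.le]

theorem A_self (b : ℕ → Bool) (u : ℕ) : A b u u = 0 := by simp [A, adjB]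

def d (b : ℕ → Bool) (n u : ℕ) : ℤ := ∑ v ∈ range n, A b u v

theorem d_succ_lt {b : ℕ → Bool} {u n : ℕ} (h : u < n) :
    d b (n+1) u = d b n u + if b n then 1 else 0 := by
  rw [d, sum_range_succ, A_lt h, d]

theorem d_succ_self (b : ℕ → Bool) (n : ℕ) : d b (n+1) n = if b n then (n:ℤ) else 0 := by
  rw [d, sum_range_succ, A_self, add_zero]
  rw [sum_congr rfl (g := fun _ => if b n then (1:ℤ) else 0)]
  · split <;> simp
  · intro v hv
    rw [A_comm, A_lt (mem_range.mp hv)]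

theorem sum_d (b : ℕ → Bool) (n : ℕ) : ∑ u ∈ range n, d b n u = 2 * E b n := by
  induction n with
  | zero => simp [E]
  | succ n ih =>
    rw [sum_range_succ, sum_congr rfl (fun u hu => d_succ_lt (mem_range.mp hu)), d_succ_self,
      sum_add_distrib, ih]
    cases h : b n
    · rw [E_f h]; simp
    · rw [E_t h]; simp; ring

theorem sum_d2 (b : ℕ → Bool) (n : ℕ) : ∑ u ∈ range n, d b n u ^ 2 = Z b n := by
  induction n with
  | zero => simp [Z]
  | succ n ih =>
    rw [sum_range_succ, sum_congr rfl (fun u hu => by rw [d_succ_lt (mem_range.mp hu)]),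
      d_succ_self]
    cases h : b n
    · rw [Z_f h, ← ih]; simp
    · rw [Z_t h, ← ih]
      have := sum_d b n
      simp only [if_true]
      rw [sum_congr rfl (g := fun u => d b n u ^ 2 + 2 * d b n u + 1) (fun u _ => by ring),
        sum_add_distrib, sum_add_distrib, ← mul_sum, this]
      simp; ring

theorem sum_dd (b : ℕ → Bool) (n : ℕ) :
    ∑ u ∈ range n, ∑ v ∈ range n, A b u v * (d b n u * d b n v) = 2 * M2s b n := by
  induction n with
  | zero => simp [M2s]
  | succ n ih =>
    rw [sum_range_succ]
    have e1 : ∑ v ∈ range (n+1), A b n v * (d b (n+1) n * d b (n+1) v) =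
        ∑ v ∈ range n, A b v n * (d b (n+1) v * d b (n+1) n) := by
      rw [sum_range_succ, A_self, zero_mul, add_zero]
      exact sum_congr rfl (fun v _ => by rw [A_comm]; ring)
    rw [e1]
    simp_rw [sum_range_succ _ n]
    rw [sum_add_distrib]
    have e2 : ∑ v ∈ range n, A b v n * (d b (n+1) v * d b (n+1) n) =
      ∑ v ∈ range n, (if b n then (1:ℤ) else 0) * ((d b n v + if b n then 1 else 0) * if b n then (n:ℤ) else 0) := by
      refine sum_congr rfl (fun v hv => ?_)
      rw [A_lt (mem_range.mp hv), d_succ_lt (mem_range.mp hv), d_succ_self]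
    have e3 : ∑ u ∈ range n, ∑ v ∈ range n, A b u v * (d b (n+1) u * d b (n+1) v) =
      ∑ u ∈ range n, ∑ v ∈ range n, A b u v * ((d b n u + if b n then 1 else 0) * (d b n v + if b n then 1 else 0)) := by
      refine sum_congr rfl (fun u hu => sum_congr rfl (fun v hv => ?_))
      rw [d_succ_lt (mem_range.mp hv), d_succ_lt (mem_range.mp hu)]
    rw [e2, e3]
    cases h : b n
    · simp [M2s, h, ← ih]
    · simp only [M2s, h, if_true]
      have e4 : ∑ u ∈ range n, ∑ v ∈ range n, A b u v * ((d b n u + 1) * (d b n v + 1)) =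
        ∑ u ∈ range n, ∑ v ∈ range n, A b u v * (d b n u * d b n v) +
        ∑ u ∈ range n, ∑ v ∈ range n, A b u v * d b n u +
        ∑ u ∈ range n, ∑ v ∈ range n, A b u v * d b n v +
        ∑ u ∈ range n, ∑ v ∈ range n, A b u v := by
        simp_rw [← sum_add_distrib]
        exact sum_congr rfl (fun u hu => sum_congr rfl (fun v hv => by ring))
      have e5 : ∑ u ∈ range n, ∑ v ∈ range n, A b u v * d b n u = Z b n := by
        rw [← sum_d2]
        refine sum_congr rfl (fun u hu => ?_)
        rw [← sum_mul, ← d]; ring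
      have e6 : ∑ u ∈ range n, ∑ v ∈ range n, A b u v * d b n v = Z b n := by
        rw [sum_comm, ← e5]
        exact sum_congr rfl (fun u hu => sum_congr rfl (fun v hv => by rw [A_comm]))
      have e7 : ∑ u ∈ range n, ∑ v ∈ range n, A b u v = 2 * E b n := sum_d b n
      have e8 : ∑ v ∈ range n, (1:ℤ) * ((d b n v + 1) * n) = (2 * E b n + n) * n := by
        simp_rw [one_mul]
        rw [← sum_mul, sum_add_distrib, sum_d]; simp
      rw [e4, e5, e6, e7, e8, ih]
      ring

def ck (b : ℕ → Bool) (r n : ℕ) : ℕ :=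
  #{s ∈ powersetCard r (range n) | ∀ u ∈ s, ∀ v ∈ s, u ≠ v → adjB b u v}

theorem ck_succ (b : ℕ → Bool) (r n : ℕ) :
    ck b (r+2) (n+1) = ck b (r+2) n + if b n then ck b (r+1) n else 0 := by
  rw [ck, range_add_one, powersetCard_succ_insert (by simp), filter_union, card_union_of_disjoint, ck]
  · congr 1
    rw [filter_image, card_image_of_injOn]
    · rw [ck]
      cases h : b n
      · simp only [Bool.false_eq_true, if_false, card_eq_zero, filter_eq_empty_iff]
        intro s hs hcon
        rw [mem_powersetCard] at hs
        obtain ⟨x, hx⟩ : s.Nonempty := by rw [← card_pos]; omega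
        have hxn := mem_range.mp (hs.1 hx)
        have := hcon x (mem_insert_of_mem hx) n (mem_insert_self _ _) hxn.ne
        rw [adjB, max_eq_right hxn.le, h] at this
        simp at this
      · simp only [if_true]
        congr 1
        refine filter_congr (fun s hs => ?_)
        rw [mem_powersetCard] at hs
        constructor
        · intro h1 u hu v hv
          exact h1 u (mem_insert_of_mem hu) v (mem_insert_of_mem hv)
        · intro h1 u hu v hv huv
          have key : ∀ x ∈ s, adjB b x n := by
            intro x hx
            have hxn := mem_range.mp (hs.1 hx)
            exact ⟨hxn.ne, by rw [max_eq_right hxn.le, h]⟩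
          rcases mem_insert.mp hu with rfl | hu' <;> rcases mem_insert.mp hv with rfl | hv'
          · exact absurd rfl huv
          · exact adjB_symm (key v hv')
          · exact key u hu'
          · exact h1 u hu' v hv' huv
    · intro s hs s' hs' hss
      simp only [coe_filter, mem_powersetCard, Set.mem_ofPred_eq] at hs hs'
      have h1 : n ∉ s := fun h => by simpa using hs.1.1 h
      have h2 : n ∉ s' := fun h => by simpa using hs'.1.1 h
      rw [← erase_insert h1, hss, erase_insert h2]
  · rw [disjoint_left]
    intro s hs hs'
    simp only [mem_filter, mem_powersetCard, mem_image] at hs hs'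
    obtain ⟨⟨s', _, rfl⟩, _⟩ := hs'
    have := hs.1.1 (mem_insert_self n s')
    simp at this

theorem ck_one (b : ℕ → Bool) (n : ℕ) : ck b 1 n = n := by
  rw [ck, filter_true_of_mem]
  · simp
  · intro s hs
    rw [mem_powersetCard] at hs
    obtain ⟨x, rfl⟩ := card_eq_one.mp hs.2
    intro u hu v hv huv
    rw [mem_singleton] at hu hv
    exact absurd (hu.trans hv.symm) huv

theorem ck_two (b : ℕ → Bool) (n : ℕ) : ck b 2 n = E b n := by
  induction n with
  | zero => simp [ck, E]
  | succ n ih => rw [ck_succ, ih, zero_add, ck_one]; cases h : b n <;> simp [E, h]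

theorem ck_three (b : ℕ → Bool) (n : ℕ) : ck b 3 n = Ks b n := by
  induction n with
  | zero => simp [ck, Ks]
  | succ n ih => rw [ck_succ, ih, ck_two]; cases h : b n <;> simp [Ks, h]

theorem ncard_TG (n : ℕ) (b : ℕ → Bool) (u : Fin n) :
    (((TG n b).neighborSet u).ncard : ℤ) = d b n u := by
  classical
  rw [Set.ncard_eq_toFinset_card', d, ← Fin.sum_univ_eq_sum_range (fun v => A b u v)]
  simp only [A]
  rw [sum_boole]
  congr 2
  ext v
  rw [Set.mem_toFinset, mem_filter]
  exact ⟨fun h => ⟨mem_univ _, h⟩, fun h => h.2⟩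

theorem two_edge {V : Type} [Fintype V] (G : SimpleGraph V) :
    ∑ v, (G.neighborSet v).ncard = 2 * edgeCount G := by
  classical
  have := G.sum_degrees_eq_twice_card_edges
  rw [edgeCount, Set.ncard_eq_toFinset_card']
  rw [SimpleGraph.edgeFinset] at this
  rw [← this]
  refine sum_congr rfl (fun v _ => ?_)
  rw [Set.ncard_eq_toFinset_card']
  rfl

theorem edge_TG (n : ℕ) (b : ℕ → Bool) : edgeCount (TG n b) = E b n := by
  have h := two_edge (TG n b)
  zify at h
  rw [sum_congr rfl (fun u _ => ncard_TG n b u), Fin.sum_univ_eq_sum_range (fun u => d b n u), sum_d] at h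
  omega

theorem M1_TG (n : ℕ) (b : ℕ → Bool) : (M1 (TG n b) : ℤ) = Z b n := by
  rw [M1]
  push_cast
  rw [sum_congr rfl (fun u _ => by rw [ncard_TG n b u]), Fin.sum_univ_eq_sum_range (fun u => d b n u ^ 2), sum_d2]

theorem M2_TG (n : ℕ) (b : ℕ → Bool) : (M2 (TG n b) : ℤ) = M2s b n := by
  classical
  rw [M2]
  push_cast
  have : ∑ u : Fin n, ∑ v : Fin n, (if (TG n b).Adj u v then (((TG n b).neighborSet u).ncard : ℤ) * (((TG n b).neighborSet v).ncard : ℤ) else 0) = 2 * M2s b n := by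
    rw [← sum_dd, ← Fin.sum_univ_eq_sum_range (fun u => ∑ v ∈ range n, A b u v * (d b n u * d b n v))]
    refine sum_congr rfl (fun u _ => ?_)
    rw [← Fin.sum_univ_eq_sum_range (fun v => A b u v * (d b n u * d b n v))]
    refine sum_congr rfl (fun v _ => ?_)
    rw [ncard_TG, ncard_TG, A]
    by_cases h : adjB b u v
    · have h' : (TG n b).Adj u v := h
      simp [h, h']
    · have h' : ¬ (TG n b).Adj u v := h
      simp [h, h']
  rw [this]; simp

theorem k3_TG (n : ℕ) (b : ℕ → Bool) : k3 (TG n b) = Ks b n := by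
  rw [k3, ← ck_three, ck, ← Set.ncard_coe_finset,
    ← Set.ncard_image_of_injective _ (Finset.map_injective (Fin.valEmbedding (n := n)))]
  congr 1
  ext s
  simp only [Set.mem_image, Set.mem_ofPred_eq, coe_filter, mem_powersetCard]
  constructor
  · rintro ⟨s, hs, rfl⟩
    refine ⟨⟨?_, ?_⟩, ?_⟩
    · intro x hx
      rw [mem_map] at hx
      obtain ⟨y, _, rfl⟩ := hx
      simp
    · rw [card_map]; exact hs.card_eq
    · intro u hu v hv huv
      rw [mem_map] at hu hv
      obtain ⟨x, hx, rfl⟩ := hu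
      obtain ⟨y, hy, rfl⟩ := hv
      exact hs.isClique hx hy (fun h => huv (by rw [h]))
  · rintro ⟨⟨h1, h2⟩, h3⟩
    refine ⟨s.attachFin (fun x hx => mem_range.mp (h1 hx)), ?_, ?_⟩
    · rw [SimpleGraph.isNClique_iff]
      refine ⟨?_, by rw [card_attachFin, h2]⟩
      intro u hu v hv huv
      simp only [mem_coe, mem_attachFin] at hu hv
      exact h3 u hu v hv (fun h => huv (Fin.ext h))
    · ext x
      simp only [mem_map, mem_attachFin, Fin.valEmbedding_apply]
      constructor
      · rintro ⟨y, hy, rfl⟩; exact hy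
      · intro hx; exact ⟨⟨x, mem_range.mp (h1 hx)⟩, hx, rfl⟩

def Hs (b : ℕ → Bool) (n : ℕ) : ℤ := M2s b n - 6 * Ks b n

theorem H_TG (n : ℕ) (b : ℕ → Bool) : Hval (TG n b) = Hs b n := by
  rw [Hval, M2_TG, k3_TG, Hs]

theorem TG_compl (n : ℕ) (b : ℕ → Bool) : (TG n b)ᶜ = TG n (nb b) := by
  ext u v
  simp only [SimpleGraph.compl_adj, TG, adjB, nb]
  have : (u:ℕ) ≠ v ↔ u ≠ v := by rw [Ne, Fin.val_inj]
  rw [this]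
  by_cases h : u = v <;> simp [h]

theorem iso_ncard {V W : Type} {G : SimpleGraph V} {G' : SimpleGraph W} (e : G ≃g G') (v : V) :
    (G'.neighborSet (e v)).ncard = (G.neighborSet v).ncard := by
  rw [← Nat.card_coe_set_eq, ← Nat.card_coe_set_eq]
  exact (Nat.card_congr (e.mapNeighborSet v)).symm

theorem iso_edge {V W : Type} {G : SimpleGraph V} {G' : SimpleGraph W} (e : G ≃g G') :
    edgeCount G = edgeCount G' := by
  rw [edgeCount, edgeCount, ← Nat.card_coe_set_eq, ← Nat.card_coe_set_eq]
  exact Nat.card_congr e.mapEdgeSet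

theorem iso_M1 {V W : Type} [Fintype V] [Fintype W] {G : SimpleGraph V} {G' : SimpleGraph W}
    (e : G ≃g G') : M1 G = M1 G' := by
  rw [M1, M1]
  refine Fintype.sum_equiv e.toEquiv _ _ (fun v => ?_)
  rw [← iso_ncard e v]; rfl

theorem iso_M2 {V W : Type} [Fintype V] [Fintype W] {G : SimpleGraph V} {G' : SimpleGraph W}
    (e : G ≃g G') : M2 G = M2 G' := by
  rw [M2, M2]
  congr 1
  refine Fintype.sum_equiv e.toEquiv _ _ (fun u => Fintype.sum_equiv e.toEquiv _ _ (fun v => ?_))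
  rw [← iso_ncard e v, ← iso_ncard e u]
  have : G'.Adj (e.toEquiv u) (e.toEquiv v) ↔ G.Adj u v := e.map_adj_iff
  by_cases h : G.Adj u v
  · rw [if_pos h, if_pos (this.mpr h)]; rfl
  · rw [if_neg h, if_neg (fun h' => h (this.mp h'))]

theorem iso_k3_le {V W : Type} [Fintype V] [Fintype W] {G : SimpleGraph V} {G' : SimpleGraph W}
    (e : G ≃g G') : k3 G ≤ k3 G' := by
  rw [k3, k3, ← Set.ncard_image_of_injective _ (Finset.map_injective e.toEquiv.toEmbedding)]
  apply Set.ncard_le_ncard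
  · rintro _ ⟨s, hs, rfl⟩
    simp only [Set.mem_ofPred_eq, SimpleGraph.isNClique_iff] at hs ⊢
    refine ⟨?_, by rw [card_map]; exact hs.2⟩
    intro u hu v hv huv
    simp only [coe_map, Set.mem_image, mem_coe] at hu hv
    obtain ⟨x, hx, rfl⟩ := hu
    obtain ⟨y, hy, rfl⟩ := hv
    have := hs.1 hx hy (fun h => huv (by rw [h]))
    exact e.map_adj_iff.mpr this
  · exact Set.toFinite _

theorem iso_H {V W : Type} [Fintype V] [Fintype W] {G : SimpleGraph V} {G' : SimpleGraph W}
    (e : G ≃g G') : Hval G = Hval G' := by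
  rw [Hval, Hval, iso_M2 e, le_antisymm (iso_k3_le e) (iso_k3_le e.symm)]

end ZG

namespace ZG
open Finset

def vic {V : Type} (G : SimpleGraph V) (u v : V) : Prop := ∀ w, G.Adj u w → w = v ∨ G.Adj v w

theorem vic_trans {V : Type} {G : SimpleGraph V} {x y z : V} (h1 : vic G x y) (h2 : vic G y z) :
    vic G x z := by
  intro w hw
  rcases h1 w hw with rfl | h
  · rcases h2 x hw.symm with rfl | h
    · exact Or.inr hw
    · rcases h1 z h.symm with rfl | h'
      · exact Or.inl rfl
      · exact Or.inr h'.symm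
  · exact h2 w h

def nested {V : Type} (G : SimpleGraph V) : Prop := ∀ u v, vic G u v ∨ vic G v u

theorem exists_max_vic {V : Type} {G : SimpleGraph V} (h : nested G) (s : Finset V)
    (hs : s.Nonempty) : ∃ v ∈ s, ∀ u ∈ s, vic G u v := by
  induction hs using Finset.Nonempty.cons_induction with
  | singleton a =>
    refine ⟨a, by simp, fun u hu => ?_⟩
    rw [mem_singleton] at hu; subst hu
    exact fun w hw => Or.inr hw
  | cons a s ha hs ih =>
    obtain ⟨v, hv, hmax⟩ := ih
    rcases h a v with h1 | h1
    · refine ⟨v, by simp [hv], fun u hu => ?_⟩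
      rcases mem_cons.mp hu with rfl | hu
      · exact h1
      · exact hmax u hu
    · refine ⟨a, by simp, fun u hu => ?_⟩
      rcases mem_cons.mp hu with rfl | hu
      · exact fun w hw => Or.inr hw
      · exact vic_trans (hmax u hu) h1

theorem exists_ext {V : Type} [Fintype V] [Nonempty V] {G : SimpleGraph V} (h : nested G) :
    ∃ (w : V) (β : Bool), ∀ x, x ≠ w → (G.Adj x w ↔ β = true) := by
  obtain ⟨v, -, hv⟩ := exists_max_vic h univ univ_nonempty
  by_cases hd : ∀ x, x ≠ v → G.Adj x v
  · exact ⟨v, true, fun x hx => by simp [hd x hx]⟩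
  · push Not at hd
    obtain ⟨w, hw, hwv⟩ := hd
    refine ⟨w, false, fun x hx => ?_⟩
    simp only [Bool.false_eq_true, iff_false]
    intro hxw
    rcases hv x (mem_univ _) w hxw with h1 | h1
    · exact hw h1
    · exact hwv h1.symm

theorem iso_TG (N : ℕ) : ∀ (V : Type) [Fintype V] (G : SimpleGraph V), Fintype.card V = N →
    nested G → ∃ b, Nonempty (G ≃g TG N b) := by
  classical
  induction N with
  | zero =>
    intro V _ G hc _
    have : IsEmpty V := Fintype.card_eq_zero_iff.mp hc
    exact ⟨fun _ => false, ⟨⟨Equiv.equivOfIsEmpty _ _, fun {a} => isEmptyElim a⟩⟩⟩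
  | succ N ih =>
    intro V _ G hc hn
    have : Nonempty V := Fintype.card_pos_iff.mp (by omega)
    obtain ⟨w, β, hw⟩ := exists_ext hn
    have hn' : nested (G.comap (Subtype.val : {x // x ≠ w} → V)) := by
      intro u v
      rcases hn u v with h | h
      · left
        intro z hz
        rcases h z hz with h1 | h1
        · exact Or.inl (Subtype.ext h1)
        · exact Or.inr h1
      · right
        intro z hz
        rcases h z hz with h1 | h1
        · exact Or.inl (Subtype.ext h1)
        · exact Or.inr h1
    have hcard : Fintype.card {x // x ≠ w} = N := by
      rw [Fintype.card_subtype_compl, hc]; simp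
    obtain ⟨b, ⟨e⟩⟩ := ih {x // x ≠ w} _ hcard hn'
    refine ⟨fun v => if v = N then β else b v, ⟨⟨((Equiv.optionSubtypeNe w).symm.trans
      (Equiv.optionCongr e.toEquiv)).trans finSuccEquivLast.symm, ?_⟩⟩⟩
    intro x y
    have key : ∀ x : V, x ≠ w → ((TG (N+1) (fun v => if v = N then β else b v)).Adj
      ((((Equiv.optionSubtypeNe w).symm.trans
      (Equiv.optionCongr e.toEquiv)).trans finSuccEquivLast.symm) x)
      ((((Equiv.optionSubtypeNe w).symm.trans
      (Equiv.optionCongr e.toEquiv)).trans finSuccEquivLast.symm) w) ↔ G.Adj x w) := by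
      intro x hx
      rw [hw x hx]
      simp only [Equiv.trans_apply, Equiv.optionSubtypeNe_symm_self,
        Equiv.optionSubtypeNe_symm_of_ne hx, Equiv.optionCongr_apply, Option.map_some,
        Option.map_none, finSuccEquivLast_symm_some, finSuccEquivLast_symm_none]
      simp only [TG, adjB, Fin.val_castSucc, Fin.val_last]
      have := (e.toEquiv ⟨x, hx⟩).isLt
      rw [max_eq_right this.le]
      simp
      intro _
      exact this.ne
    by_cases hx : x = w
    · by_cases hy : y = w
      · subst hx; subst hy; simp
      · subst hx
        rw [SimpleGraph.adj_comm, key y hy, SimpleGraph.adj_comm]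
    · by_cases hy : y = w
      · subst hy
        exact key x hx
      · simp only [Equiv.trans_apply, 
          Equiv.optionSubtypeNe_symm_of_ne hx, Equiv.optionSubtypeNe_symm_of_ne hy, Equiv.optionCongr_apply, Option.map_some,
          finSuccEquivLast_symm_some]
        have h1 : (TG N b).Adj (e.toEquiv ⟨x,hx⟩) (e.toEquiv ⟨y,hy⟩) ↔ G.Adj x y := e.map_adj_iff
        rw [← h1]
        simp only [TG, adjB, Fin.val_castSucc]
        have l1 := (e.toEquiv ⟨x, hx⟩).isLt
        have l2 := (e.toEquiv ⟨y, hy⟩).isLt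
        rw [if_neg (by have := max_lt l1 l2; omega)]

def swapG {V : Type} (G : SimpleGraph V) (u v w : V) (huw : u ≠ w) : SimpleGraph V where
  Adj x y := (G.Adj x y ∧ s(x,y) ≠ s(v,w)) ∨ s(x,y) = s(u,w)
  symm := ⟨fun x y h => by rw [Sym2.eq_swap (a := y), G.adj_comm y x]; exact h⟩
  loopless := ⟨fun x h => by
    rcases h with h | h
    · exact G.loopless.irrefl x h.1
    · rw [Sym2.eq_iff] at h
      rcases h with ⟨h1, h2⟩ | ⟨h1, h2⟩ <;> exact huw (by rw [← h1, ← h2])⟩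

theorem swap_ncard {V : Type} [Fintype V] [DecidableEq V] (G : SimpleGraph V) (u v w : V) (huw : u ≠ w)
    (h1 : G.Adj v w) (h2 : ¬ G.Adj u w) (x : V) :
    (((swapG G u v w huw).neighborSet x).ncard : ℤ) = (G.neighborSet x).ncard
      + ((if x = u then 1 else 0) - (if x = v then 1 else 0)) := by
  have huv : u ≠ v := by rintro rfl; exact h2 h1
  have hvw : v ≠ w := h1.ne
  by_cases hu : x = u
  · subst hu
    rw [if_pos rfl, if_neg huv]
    have : (swapG G x v w huw).neighborSet x = insert w (G.neighborSet x) := by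
      ext y
      simp only [SimpleGraph.mem_neighborSet, swapG, Set.mem_insert_iff, Sym2.eq_iff, Ne]
      grind
    rw [this, Set.ncard_insert_of_notMem (by exact h2) (Set.toFinite _)]
    simp
  by_cases hv : x = v
  · subst hv
    rw [if_pos rfl, if_neg hu]
    have : (swapG G u x w huw).neighborSet x = (G.neighborSet x) \ {w} := by
      ext y
      simp only [SimpleGraph.mem_neighborSet, swapG, Set.mem_sdiff, Set.mem_singleton_iff, Sym2.eq_iff, Ne]
      grind
    rw [this]
    have := Set.ncard_sdiff_singleton_add_one (s := G.neighborSet x) (a := w) h1 (Set.toFinite _)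
    omega
  rw [if_neg hu, if_neg hv]
  by_cases hw : x = w
  · subst hw
    have : (swapG G u v x huw).neighborSet x = insert u ((G.neighborSet x) \ {v}) := by
      ext y
      simp only [SimpleGraph.mem_neighborSet, swapG, Set.mem_sdiff, Set.mem_singleton_iff, Set.mem_insert_iff, Sym2.eq_iff, Ne]
      grind
    rw [this, Set.ncard_insert_of_notMem (by
      intro h; exact h2 (h.1 : G.Adj x u).symm) (Set.toFinite _)]
    have := Set.ncard_sdiff_singleton_add_one (s := G.neighborSet x) (a := v) h1.symm (Set.toFinite _)
    omega
  · have : (swapG G u v w huw).neighborSet x = G.neighborSet x := by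
      ext y
      simp only [SimpleGraph.mem_neighborSet, swapG, Sym2.eq_iff, Ne]
      grind
    rw [this]; simp

theorem swap_better {V : Type} [Fintype V] (G : SimpleGraph V) (u v w : V) (huw : u ≠ w)
    (h1 : G.Adj v w) (h2 : ¬ G.Adj u w) (hd : (G.neighborSet v).ncard ≤ (G.neighborSet u).ncard) :
    edgeCount (swapG G u v w huw) = edgeCount G ∧ M1 G < M1 (swapG G u v w huw) := by
  classical
  have huv : u ≠ v := by rintro rfl; exact h2 h1
  have hn := swap_ncard G u v w huw h1 h2
  constructor
  · have e1 := two_edge (swapG G u v w huw)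
    have e2 := two_edge G
    zify at e1 e2
    rw [sum_congr rfl (fun x _ => hn x), sum_add_distrib, e2, sum_sub_distrib] at e1
    simp at e1
    omega
  · zify
    rw [M1, M1]
    push_cast
    have : ∀ x, (((swapG G u v w huw).neighborSet x).ncard : ℤ)^2 = ((G.neighborSet x).ncard : ℤ)^2 
      + ((if x = u then 2 * ((G.neighborSet x).ncard : ℤ) + 1 else 0) - (if x = v then 2 * ((G.neighborSet x).ncard : ℤ) - 1 else 0)) := by
      intro x
      rw [hn x]
      by_cases hu : x = u
      · rw [if_pos hu, if_neg (by rw [hu]; exact huv), if_pos hu, if_neg (by rw [hu]; exact huv)]; ring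
      · rw [if_neg hu, if_neg hu]
        split <;> ring
    rw [sum_congr rfl (fun x _ => this x), sum_add_distrib, sum_sub_distrib]
    simp
    omega

theorem opt_nested {V : Type} [Fintype V] {m : ℕ} {G : SimpleGraph V} (h : MOptimal m G) : nested G := by
  intro u v
  by_contra hcon
  push Not at hcon
  obtain ⟨c1, c2⟩ := hcon
  simp only [vic, not_forall, not_or] at c1 c2
  have key : ∀ u v, (∃ w, ∃ _ : G.Adj v w, ¬ w = u ∧ ¬ G.Adj u w) →
      ¬ (G.neighborSet v).ncard ≤ (G.neighborSet u).ncard := by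
    rintro u v ⟨w, h1, h2, h3⟩ hd
    obtain ⟨e1, e2⟩ := swap_better G u v w (fun h => h2 h.symm) h1 h3 hd
    have := h.2 _ (e1.trans h.1)
    omega
  have k1 := key u v c2
  have k2 := key v u c1
  omega

/-- every graph is bounded -/
theorem exists_opt {n m : ℕ} (G : SimpleGraph (Fin n)) (h : edgeCount G = m) :
    ∃ G' : SimpleGraph (Fin n), MOptimal m G' := by
  classical
  obtain ⟨G', h1, h2⟩ := Finset.exists_max_image {H : SimpleGraph (Fin n) | edgeCount H = m} M1
    ⟨G, by simp [h]⟩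
  exact ⟨G', by simpa using h1, fun H hH => h2 H (by simp [hH])⟩

theorem opt_TG {n m : ℕ} {G : SimpleGraph (Fin n)} (h : MOptimal m G) :
    ∃ b, Nonempty (G ≃g TG n b) := iso_TG n (Fin n) G (by simp) (opt_nested h)

end ZG

namespace ZG
open Finset

theorem M_f {b : ℕ → Bool} {n : ℕ} (h : b n = false) : M2s b (n+1) = M2s b n := by simp [M2s, h]
theorem M_t {b : ℕ → Bool} {n : ℕ} (h : b n = true) :
    M2s b (n+1) = M2s b n + Z b n + E b n + n * (2 * E b n + n) := by simp [M2s, h]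
theorem K_f {b : ℕ → Bool} {n : ℕ} (h : b n = false) : Ks b (n+1) = Ks b n := by simp [Ks, h]
theorem K_t {b : ℕ → Bool} {n : ℕ} (h : b n = true) : Ks b (n+1) = Ks b n + E b n := by simp [Ks, h]

theorem tail {b : ℕ → Bool} {n0 n : ℕ} (hn : n0 ≤ n) (h : ∀ v, n0 ≤ v → v < n → b v = false) :
    E b n = E b n0 ∧ Z b n = Z b n0 ∧ M2s b n = M2s b n0 ∧ Ks b n = Ks b n0 := by
  induction n, hn using Nat.le_induction with
  | base => simp
  | succ n hn ih =>
    have hf := h n hn (by omega)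
    rw [E_f hf, Z_f hf, M_f hf, K_f hf]
    exact ih (fun v h1 h2 => h v h1 (by omega))

theorem blockK {b : ℕ → Bool} (j : ℕ) (h : ∀ v, 1 ≤ v → v < j → b v = true) :
    2 * (E b j : ℤ) = j * (j-1) ∧ Z b j = j*(j-1)^2 ∧ 2 * M2s b j = j*(j-1)^3 ∧
    6 * (Ks b j : ℤ) = j*(j-1)*(j-2) := by
  induction j with
  | zero => simp [E, Z, M2s, Ks]
  | succ j ih =>
    obtain ⟨h1, h2, h3, h4⟩ := ih (fun v h1 h2 => h v h1 (by omega))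
    by_cases hj : j = 0
    · subst hj
      simp [E, Z, M2s, Ks]
    · have ht := h j (by omega) (by omega)
      rw [E_t ht, Z_t ht, M_t ht, K_t ht]
      push_cast
      refine ⟨by linear_combination h1, by linear_combination h2 + 2 * h1,
        by linear_combination h3 + 2 * h2 + (1 + 2 * j) * h1, by linear_combination h4 + 3 * h1⟩

theorem block1 {b : ℕ → Bool} (j i : ℕ) (h : ∀ v, 1 ≤ v → v < j → b v = true)
    (hj : b j = false) (h' : ∀ v, j < v → v ≤ j + i → b v = true) :
    2 * (E b (j+i+1) : ℤ) = (j+i) * (j+i-1) + 2*i ∧ Z b (j+i+1) = CV (j+i) i ∧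
    2 * M2s b (j+i+1) = (j+i)*(j+i-1)^3 + 2*(j+i-1)^2*i+i*(i-1)+2*i^2*(j+i) ∧
    6 * (Ks b (j+i+1) : ℤ) = (j+i)*(j+i-1)*(j+i-2) + 3*i*(i-1) := by
  induction i with
  | zero =>
    obtain ⟨h1, h2, h3, h4⟩ := blockK j h
    rw [add_zero, E_f hj, Z_f hj, M_f hj, K_f hj, CV]
    push_cast
    refine ⟨by linear_combination h1, by linear_combination h2, by linear_combination h3,
      by linear_combination h4⟩
  | succ i ih =>
    obtain ⟨h1, h2, h3, h4⟩ := ih (fun v h1 h2 => h' v h1 (by omega))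
    have ht : b (j+i+1) = true := h' _ (by omega) (by omega)
    rw [← add_assoc, E_t ht, Z_t ht, M_t ht, K_t ht]
    rw [CV] at h2 ⊢
    push_cast at *
    refine ⟨by linear_combination h1, by linear_combination h2 + 2 * h1,
        by linear_combination h3 + 2 * h2 + (3 + 2 * (j+i)) * h1, by linear_combination h4 + 3 * h1⟩

theorem block3 {b : ℕ → Bool} (i : ℕ) (h1 : b 1 = false) (h2 : b 2 = false)
    (h' : ∀ v, 3 ≤ v → v < 3 + i → b v = true) :
    2 * (E b (3+i) : ℤ) = i*(i-1)+6*i ∧ Z b (3+i) = i*(i+2)^2+3*i^2 ∧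
    2 * M2s b (3+i) = i*(i-1)*(i+2)^2+6*i^2*(i+2) ∧
    6 * (Ks b (3+i) : ℤ) = i*(i-1)*(i-2)+9*i*(i-1) := by
  induction i with
  | zero => simp [E, Z, M2s, Ks, h1, h2]
  | succ i ih =>
    obtain ⟨h1, h2, h3, h4⟩ := ih (fun v h1 h2 => h' v h1 (by omega))
    have ht : b (3+i) = true := h' _ (by omega) (by omega)
    rw [← add_assoc, E_t ht, Z_t ht, M_t ht, K_t ht]
    push_cast at *
    refine ⟨by linear_combination h1, by linear_combination h2 + 2 * h1,
        by linear_combination h3 + 2 * h2 + (1 + 2 * (3+i)) * h1, by linear_combination h4 + 3 * h1⟩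

/-- twice the H value of the quasi-complete graph -/
def HC (a t : ℤ) : ℤ := a*(a-1)^3 + 2*(a-1)^2*t+t*(t-1)+2*t^2*a - 2*(a*(a-1)*(a-2) + 3*t*(t-1))

theorem F1_vals {n a t : ℕ} {b : ℕ → Bool} (hta : t < a) (han : a + 1 ≤ n) (h : F1 n a t b) :
    2 * (E b n : ℤ) = a * (a-1) + 2*t ∧ Z b n = CV a t ∧ 2 * Hs b n = HC a t := by
  obtain ⟨-, -, h⟩ := h
  obtain ⟨j, rfl⟩ : ∃ j, a = j + t := ⟨a - t, by omega⟩
  have hjt : j + t - t = j := by omega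
  rw [hjt] at h
  have h0 := tail (b := b) (n0 := j+t+1) han (fun v h1 h2 => by
    have := h v (by omega) h2
    rw [← Bool.not_eq_true, this]; omega)
  obtain ⟨h1, h2, h3, h4⟩ := block1 (b := b) j t
    (fun v h1 h2 => (h v h1 (by omega)).mpr ⟨by omega, by omega⟩)
    (by rw [← Bool.not_eq_true, h j (by omega) (by omega)]; omega)
    (fun v h1 h2 => (h v (by omega) (by omega)).mpr ⟨by omega, by omega⟩)
  rw [Hs, h0.1, h0.2.1, h0.2.2.1, h0.2.2.2, HC]
  push_cast
  exact ⟨h1, h2, by linear_combination h3 - 2 * h4⟩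

theorem F2_vals {n a t : ℕ} {b : ℕ → Bool} (ha : 2 ≤ a) (ht : 1 ≤ t) (h : F2 n a t b) :
    2 * Hs b n = a*(a-1)^3 + 2*(a-1)^2*t+2*t*(a-1+t) - 2*(a*(a-1)*(a-2)) := by
  obtain ⟨h0, h⟩ := h
  obtain ⟨c, rfl⟩ : ∃ c, a = c + 1 := ⟨a - 1, by omega⟩
  have e0 := tail (b := b) (n0 := c+t+1) (n := n) (by omega) (fun v h1 h2 => by
    have := h v (by omega) h2
    rw [← Bool.not_eq_true, this]; omega)
  have e1 := tail (b := b) (n0 := c) (n := c+t) (by omega) (fun v h1 h2 => by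
    have := h v (by omega) (by omega)
    rw [← Bool.not_eq_true, this]; omega)
  obtain ⟨h1, h2, h3, h4⟩ := blockK (b := b) c
    (fun v h1 h2 => (h v h1 (by omega)).mpr (by omega))
  have ht : b (c+t) = true := (h _ (by omega) (by omega)).mpr (by omega)
  rw [Hs, e0.2.2.1, e0.2.2.2, M_t ht, K_t ht, e1.1, e1.2.1, e1.2.2.1, e1.2.2.2]
  push_cast
  linear_combination h3 + 2 * h2 + (1 + 2*(c+t)) * h1 - 2 * h4 - 6 * h1

theorem F3_vals {n a t : ℕ} {b : ℕ → Bool} (h : F3 n a t b) :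
    2 * (E b n : ℤ) = a * (a-1) + 2*t ∧ Z b n = CV a t ∧ 2 * Hs b n = HC a t + 6 := by
  obtain ⟨h0, h0', h⟩ := h
  subst h0
  have e0 := tail (b := b) (n0 := 3+(t+1)) (n := n) (by omega) (fun v h1 h2 => by
    have := h v (by omega) h2
    rw [← Bool.not_eq_true, this]; omega)
  obtain ⟨h1, h2, h3, h4⟩ := block3 (b := b) (t+1)
    (by rw [← Bool.not_eq_true, h 1 (by omega) (by omega)]; omega)
    (by rw [← Bool.not_eq_true, h 2 (by omega) (by omega)]; omega)
    (fun v h1 h2 => (h v (by omega) (by omega)).mpr ⟨by omega, by omega⟩)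
  rw [Hs, e0.1, e0.2.1, e0.2.2.1, e0.2.2.2, HC, CV]
  push_cast at *
  refine ⟨by linear_combination h1, by linear_combination h2, by linear_combination h3 - 2 * h4⟩

def ct (b : ℕ → Bool) (n : ℕ) : ℕ := #{v ∈ range n | 1 ≤ v ∧ b v = true}

theorem ct_succ (b : ℕ → Bool) (n : ℕ) :
    ct b (n+1) = ct b n + if 1 ≤ n ∧ b n = true then 1 else 0 := by
  rw [ct, range_add_one, filter_insert]
  split
  · rw [card_insert_of_notMem (by simp)]; rfl
  · rfl

theorem crude (b : ℕ → Bool) (n : ℕ) : ct b n ≤ n ∧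
    2 * (E b n : ℤ) ≤ 2 * ct b n * (n - ct b n) + ct b n * (ct b n - 1) ∧
    Z b n ≤ (n - ct b n) * (ct b n)^2 + ct b n * (n-1)^2 ∧
    2 * M2s b n ≤ ct b n * (ct b n - 1) * (n-1)^2 + 2 * (ct b n)^2 * (n - ct b n) * (n-1) := by
  induction n with
  | zero => simp [ct, E, Z, M2s]
  | succ n ih =>
    obtain ⟨h0, h1, h2, h3⟩ := ih
    by_cases hn : n = 0
    · subst hn
      simp [ct, E, Z, M2s, filter_singleton]
    have hn1 : 1 ≤ n := by omega
    rw [ct_succ]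
    generalize ct b n = x at *
    have hn1' : (1:ℤ) ≤ n := by exact_mod_cast hn1
    have h0' : (x:ℤ) ≤ n := by exact_mod_cast h0
    have hx : (0:ℤ) ≤ x := by positivity
    cases hb : b n
    · rw [E_f hb, Z_f hb, M_f hb]
      simp only [Bool.false_eq_true, and_false, if_false, add_zero]
      push_cast
      refine ⟨by omega, by nlinarith, by nlinarith [mul_nonneg hx hx, mul_nonneg hx (sub_nonneg.mpr hn1')], ?_⟩
      have hq : (0:ℤ) ≤ x * (x-1) := by
        rcases Nat.eq_zero_or_pos x with h | h
        · subst h; simp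
        · have : (1:ℤ) ≤ x := by exact_mod_cast h
          nlinarith
      have e1 : (x:ℤ) * (x - 1) * (n-1)^2 ≤ x * (x-1) * n^2 := by
        apply mul_le_mul_of_nonneg_left _ hq; nlinarith
      have e2 : (2 * (x:ℤ)^2) * ((n - x) * (n-1)) ≤ (2 * x^2) * ((n+1-x)*n) := by
        apply mul_le_mul_of_nonneg_left _ (by positivity); nlinarith
      linarith
    · rw [E_t hb, Z_t hb, M_t hb]
      simp only [hn1, and_self, if_true]
      push_cast
      refine ⟨by omega, by linarith, by linarith, ?_⟩
      have e1 : (2 * (E b n : ℤ)) * (2 * n + 1) ≤ (2 * x * (n - x) + x * (x - 1)) * (2 * n + 1) :=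
        mul_le_mul_of_nonneg_right h1 (by positivity)
      linarith

theorem ct_add {b : ℕ → Bool} {n : ℕ} {s : Finset ℕ} (h : ∀ v ∈ s, v < n ∧ nb b v = true) :
    ct b n + #s ≤ n := by
  rw [ct, ← card_union_of_disjoint]
  · calc _ ≤ #(range n) := card_le_card (union_subset (filter_subset _ _)
          (fun v hv => mem_range.mpr (h v hv).1))
      _ = n := card_range n
  · rw [disjoint_left]
    intro v hv hv'
    have h1 := (mem_filter.mp hv).2.2
    have h2 := (h v hv').2
    simp [nb, h1] at h2

theorem ct_le {b : ℕ → Bool} {n a t : ℕ} (hta : t < a) (han : a + 1 ≤ n)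
    (h : F1 n a t (nb b) ∨ F2 n a t (nb b) ∨ F3 n a t (nb b)) : ct b n + a ≤ n + 2 := by
  rcases h with h | h | h
  · have := ct_add (b := b) (n := n) (s := (Icc 1 a).erase (a-t)) (fun v hv => by
      rw [mem_erase, mem_Icc] at hv
      exact ⟨by omega, (h.2.2 v (by omega) (by omega)).mpr (by omega)⟩)
    rw [card_erase_of_mem (by rw [mem_Icc]; omega), Nat.card_Icc] at this
    omega
  · have := ct_add (b := b) (n := n) (s := Ico 1 (a-1)) (fun v hv => by
      rw [mem_Ico] at hv
      exact ⟨by omega, (h.2 v (by omega) (by omega)).mpr (by omega)⟩)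
    rw [Nat.card_Ico] at this
    omega
  · have := ct_add (b := b) (n := n) (s := Icc 3 a) (fun v hv => by
      rw [mem_Icc] at hv
      exact ⟨by omega, (h.2.2 v (by omega) (by omega)).mpr (by omega)⟩)
    rw [Nat.card_Icc] at this
    omega

theorem crude_num {n x : ℤ} (hn : 437 ≤ n) (hx : 0 ≤ x) (h : 100 * x ≤ 31 * n) :
    10000 * (x * (x-1) * (n-1)^2 + 2 * x^2 * (n-x) * (n-1)) ≤ 2288 * n^4 := by
  have e1 : x * (x-1) * (n-1)^2 ≤ x^2 * n^2 := by
    have : x * (x-1) ≤ x^2 := by nlinarith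
    calc x * (x-1) * (n-1)^2 ≤ x^2 * (n-1)^2 := mul_le_mul_of_nonneg_right this (by positivity)
      _ ≤ x^2 * n^2 := mul_le_mul_of_nonneg_left (by nlinarith) (by positivity)
  have e2 : 2 * x^2 * (n-x) * (n-1) ≤ 2 * x^2 * (n-x) * n :=
    mul_le_mul_of_nonneg_left (by linarith) (mul_nonneg (by positivity) (by linarith))
  have e3 : 10000 * (x^2 * (3 * n - 2 * x)) ≤ 2288 * n^3 := by
    have : 0 ≤ (31 * n - 100 * x) * (300 * n * (31 * n + 100 * x) - 2 * ((31*n)^2 + 31 * n * (100 * x) + (100*x)^2)) := by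
      apply mul_nonneg (by linarith)
      nlinarith
    have : 0 ≤ n^3 := by positivity
    nlinarith
  nlinarith [mul_le_mul_of_nonneg_right e3 (by linarith : (0:ℤ) ≤ n)]

theorem HC_num {n a t : ℤ} (hn : 437 ≤ n) (h : 7 * n ≤ 10 * a) (ht : 0 ≤ t) : 
    2288 * n^4 < 10000 * HC a t := by
  have hx : 6975 * n ≤ 10000 * (a-1) := by linarith
  have hy : 69 * n ≤ 100 * (a - 3) := by linarith
  have e1 : (a-1)^3 * (a-3) ≤ HC a t := by
    rw [HC]
    have : 0 ≤ 2*(a-1)^2*t := by positivity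
    have : 0 ≤ t^2 * (2 * a - 5) := mul_nonneg (by positivity) (by linarith)
    nlinarith [sq_nonneg (a-1)]
  have e2 : (6975 * n)^3 ≤ (10000 * (a-1))^3 := pow_le_pow_left₀ (by linarith) hx 3
  have e3 : (6975*n)^3 * (69 * n) ≤ (10000 * (a-1))^3 * (100 * (a-3)) :=
    mul_le_mul e2 hy (by linarith) (pow_nonneg (by linarith) 3)
  have : 0 < n^4 := by positivity
  nlinarith

theorem crude_lt {b : ℕ → Bool} {n a t k i : ℕ} (hn : 437 ≤ n) (hta : t < a) (han : a + 1 ≤ n)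
    (h : F1 n a t (nb b) ∨ F2 n a t (nb b) ∨ F3 n a t (nb b)) (ha : 7 * n ≤ 10 * a)
    (hk : 7 * n ≤ 10 * k) : 2 * Hs b n < HC k i := by
  have h1 := ct_le hta han h
  have h2 := crude_num (n := n) (x := ct b n) (by omega) (by omega) (by omega)
  have h3 := HC_num (n := n) (a := k) (t := i) (by omega) (by omega) (by omega)
  have h4 := (crude b n).2.2.2
  have h5 : 2 * Hs b n ≤ 2 * M2s b n := by rw [Hs]; omega
  linarith

theorem regime {n m a t : ℕ} (hn : 437 ≤ n) (hta : t < a) (h : 2 * m + a = a*a+2*t)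
    (h1 : n * n ≤ 4 * m + 3 * n) (h2 : 4 * m ≤ n * n + n) : a + 1 ≤ n ∧ 7 * n ≤ 10 * a := by
  constructor
  · by_contra hc
    have : n ≤ a := by omega
    nlinarith
  · by_contra hc
    have : 10 * a + 1 ≤ 7 * n := by omega
    nlinarith

end ZG

namespace ZG
open Finset

def bC1 (k j : ℕ) : ℕ → Bool := fun v => decide (v ≤ k ∧ v ≠ j)
def bC3 (k : ℕ) : ℕ → Bool := fun v => decide (3 ≤ v ∧ v ≤ k)

theorem TG_congr {n : ℕ} {b b' : ℕ → Bool} (h : ∀ v, 1 ≤ v → v < n → (b v = true ↔ b' v = true)) :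
    TG n b = TG n b' := by
  ext u v
  show adjB b u v ↔ adjB b' u v
  unfold adjB
  refine and_congr_right (fun huv => h _ ?_ ?_)
  · have := Fin.val_ne_of_ne (fun h => huv (congrArg Fin.val h) : u ≠ v)
    omega
  · omega

theorem mk_iso {n : ℕ} (G : SimpleGraph (Fin n)) (b : ℕ → Bool) (s : ℕ → ℕ)
    (h1 : ∀ v, v < n → s v < n) (h2 : ∀ u v, u < n → v < n → s u = s v → u = v)
    (h3 : ∀ u v : Fin n, u ≠ v → (b (max (s u) (s v)) = true ↔ G.Adj u v)) :
    Nonempty (G ≃g TG n b) := by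
  let f : Fin n → Fin n := fun v => ⟨s v, h1 v v.isLt⟩
  have hf : Function.Injective f := fun u v h =>
    Fin.ext (h2 u v u.isLt v.isLt (congrArg Fin.val h))
  refine ⟨⟨Equiv.ofBijective f (Finite.injective_iff_bijective.mp hf), ?_⟩⟩
  intro u v
  show adjB b (s u) (s v) ↔ G.Adj u v
  by_cases huv : u = v
  · subst huv; simp [adjB]
  · rw [adjB, h3 u v huv]
    exact and_iff_right (fun h => huv (hf (Fin.ext h)))

def s1 (k j v : ℕ) : ℕ := if v < k - j then v + j + 1 else if v < k then v - (k-j) else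
  if v = k then j else v
def s3 (k v : ℕ) : ℕ := if v < k - 2 then v + 3 else if v < k + 1 then v - (k-2) else v

theorem iso1 {n k j : ℕ} (hj : 1 ≤ j) (hjk : j ≤ k) (hk : k + 1 ≤ n) :
    Nonempty (quasiComplete n k j ≃g TG n (bC1 k j)) := by
  apply mk_iso _ _ (s1 k j)
  · intro v hv; unfold s1; split_ifs <;> omega
  · intro u v hu hv; unfold s1; split_ifs <;> omega
  · intro u v huv
    have := Fin.val_ne_of_ne huv
    rw [quasiComplete, SimpleGraph.fromRel_adj]
    simp only [bC1, decide_eq_true_eq, huv, ne_eq, not_false_eq_true, true_and]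
    unfold s1; split_ifs <;> omega

theorem iso3 {n k : ℕ} (hjk : 3 ≤ k) (hk : k + 1 ≤ n) :
    Nonempty (quasiComplete3 n k ≃g TG n (bC3 k)) := by
  apply mk_iso _ _ (s3 k)
  · intro v hv; unfold s3; split_ifs <;> omega
  · intro u v hu hv; unfold s3; split_ifs <;> omega
  · intro u v huv
    have := Fin.val_ne_of_ne huv
    rw [quasiComplete3, SimpleGraph.fromRel_adj]
    simp only [bC3, decide_eq_true_eq, huv, ne_eq, not_false_eq_true, true_and]
    unfold s3; split_ifs <;> omega

theorem F1_bC1 {n k j : ℕ} (hjk : j ≤ k) (hk : k + 1 ≤ n) : F1 n k (k-j) (bC1 k j) := by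
  refine ⟨by omega, by omega, fun v _ _ => ?_⟩
  simp only [bC1, decide_eq_true_eq]; omega

theorem F3_bC3 {n k : ℕ} (hjk : 3 ≤ k) (hk : k + 1 ≤ n) : F3 n k (k-3) (bC3 k) := by
  refine ⟨by omega, by omega, fun v _ _ => ?_⟩
  simp only [bC3, decide_eq_true_eq]

theorem two_choose (k : ℕ) : 2 * (k+1).choose 2 = k * k + k := by
  induction k with
  | zero => simp
  | succ k ih => rw [Nat.choose_succ_succ, Nat.choose_one_right]; linarith

theorem iso_compl {V W : Type} {G : SimpleGraph V} {G' : SimpleGraph W} (e : G ≃g G') :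
    Nonempty (Gᶜ ≃g G'ᶜ) :=
  ⟨⟨e.toEquiv, by
    intro u v
    rw [SimpleGraph.compl_adj, SimpleGraph.compl_adj]
    have := e.map_adj_iff (v := u) (w := v)
    exact and_congr (not_congr e.toEquiv.injective.eq_iff) (not_congr this)⟩⟩

theorem F2_lt {n a t : ℕ} {b : ℕ → Bool} (ha : 4 ≤ a) (ht : 2 ≤ t) (h : F2 n a t b) :
    2 * Hs b n < HC a t := by
  rw [F2_vals (by omega) (by omega) h, HC]
  have h1 : (4:ℤ) ≤ a := by exact_mod_cast ha
  have h2 : (2:ℤ) ≤ t := by exact_mod_cast ht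
  have : 0 < (t:ℤ) * (t-1) * (2 * a - 7) := by
    apply mul_pos (mul_pos _ _) <;> linarith
  nlinarith

end ZG

theorem stmt17 (n m k j k' j' : ℕ) (hn : 437 ≤ n)
    (hm1 : ((n.choose 2 : ℕ) : ℚ)/2 - (n:ℚ)/2 ≤ (m:ℚ))
    (hm2 : (m:ℚ) ≤ ((n.choose 2 : ℕ) : ℚ)/2 + (n:ℚ)/2)
    (hj : 1 ≤ j) (hjk : j ≤ k) (hkj : m + j = (k+1).choose 2)
    (hj' : 1 ≤ j') (hjk' : j' ≤ k') (hkj' : m + (k'+1).choose 2 = n.choose 2 + j')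
    (hM : M1 (quasiStar n k' j') = M1 (quasiComplete n k j)) :
    (j = 3 → HOptimal m (quasiComplete3 n k) ∧
      ∀ G' : SimpleGraph (Fin n), HOptimal m G' → Nonempty (G' ≃g quasiComplete3 n k)) ∧
    (j ≠ 3 → HOptimal m (quasiComplete n k j) ∧
      ∀ G' : SimpleGraph (Fin n), HOptimal m G' → Nonempty (G' ≃g quasiComplete n k j)) := by
  have hn2 : 2 * n.choose 2 + n = n * n := by
    obtain ⟨c, rfl⟩ : ∃ c, n = c + 1 := ⟨n - 1, by omega⟩
    rw [ZG.two_choose]; ring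
  have hk2 := ZG.two_choose k
  have hk2' := ZG.two_choose k'
  have hr1 : n * n ≤ 4 * m + 3 * n := by
    have : ((2 * n.choose 2 : ℕ) : ℚ) ≤ 4 * m + 2 * n := by push_cast; linarith
    have : 2 * n.choose 2 ≤ 4 * m + 2 * n := by exact_mod_cast this
    omega
  have hr2 : 4 * m ≤ n * n + n := by
    have : (4 * m : ℚ) ≤ ((2 * n.choose 2 + 2 * n : ℕ) : ℚ) := by push_cast; linarith
    have : 4 * m ≤ 2 * n.choose 2 + 2 * n := by exact_mod_cast this
    omega
  have hrep : 2 * m + k = k * k + 2 * (k - j) := by omega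
  obtain ⟨q, hq⟩ : ∃ q, q + j' = (k'+1).choose 2 := by
    refine ⟨(k'+1).choose 2 - j', Nat.sub_add_cancel ?_⟩
    nlinarith
  have hmq : 2 * (m + q) + n = n * n := by omega
  have hrep' : 2 * q + k' = k' * k' + 2 * (k' - j') := by omega
  obtain ⟨hkn, hk7⟩ := ZG.regime hn (by omega : k - j < k) hrep hr1 hr2
  obtain ⟨hkn', -⟩ := ZG.regime hn (by omega : k' - j' < k') hrep' (by omega) (by omega)
  obtain ⟨e1⟩ := ZG.iso1 hj hjk hkn
  obtain ⟨e1'⟩ := ZG.iso1 hj' hjk' hkn'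
  obtain ⟨v1, v2, v3⟩ := ZG.F1_vals (by omega) hkn (ZG.F1_bC1 hjk hkn)
  obtain ⟨w1, w2, -⟩ := ZG.F1_vals (by omega) hkn' (ZG.F1_bC1 hjk' hkn')
  have hCf : ZG.Cf m = ZG.CV k (k-j : ℕ) := ZG.Cf_eq (by omega) hrep
  have hCf' : ZG.Cf q = ZG.CV k' (k'-j' : ℕ) := ZG.Cf_eq (by omega) hrep'
  have hE1 : ZG.E (ZG.bC1 k j) n = m := by
    zify at hrep ⊢; linarith
  have hE1' : ZG.E (ZG.bC1 k' j') n = q := by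
    zify at hrep' ⊢; linarith
  have hc1 : edgeCount (quasiComplete n k j) = m := by
    rw [ZG.iso_edge e1, ZG.edge_TG, hE1]
  have hcM : (M1 (quasiComplete n k j) : ℤ) = ZG.Cf m := by
    rw [ZG.iso_M1 e1, ZG.M1_TG, v2, hCf]
  have hcH : 2 * Hval (quasiComplete n k j) = ZG.HC k (k-j : ℕ) := by
    rw [ZG.iso_H e1, ZG.H_TG, v3]
  have hS : ZG.Sv n m q = ZG.Cf m := by
    obtain ⟨e2⟩ := ZG.iso_compl e1'
    have h1 : (M1 (quasiStar n k' j') : ℤ) = ZG.Z (ZG.nb (ZG.bC1 k' j')) n := by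
      rw [quasiStar, ZG.iso_M1 e2, ZG.TG_compl, ZG.M1_TG]
    rw [← hcM, ← hM, h1, ZG.Z_nb, hE1', w2, ZG.Sv, hCf']
    zify at hmq
    linear_combination (2 * ((n:ℤ) - 1)) * hmq
  have hmx : ∀ b, ZG.E b n = m → ZG.mx b n = ZG.Cf m := by
    intro b hb
    have h1 := ZG.bal b n
    have h2 : ZG.E (ZG.nb b) n = q := by omega
    rw [ZG.mx, hb, h2, hS, max_self]
  have hbound : ∀ G' : SimpleGraph (Fin n), edgeCount G' = m → (M1 G' : ℤ) ≤ ZG.Cf m := by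
    intro G' hG'
    obtain ⟨G, hG⟩ := ZG.exists_opt G' hG'
    obtain ⟨b, ⟨e⟩⟩ := ZG.opt_TG hG
    have h1 : ZG.E b n = m := by rw [← ZG.edge_TG, ← ZG.iso_edge e, hG.1]
    have h2 : (M1 G' : ℤ) ≤ M1 G := by exact_mod_cast hG.2 G' hG'
    rw [ZG.iso_M1 e, ZG.M1_TG] at h2
    exact h2.trans ((ZG.AK n b).trans (hmx b h1).le)
  have hmk : ∀ G : SimpleGraph (Fin n), edgeCount G = m → (M1 G : ℤ) = ZG.Cf m → MOptimal m G := by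
    intro G h1 h2
    refine ⟨h1, fun G' hG' => ?_⟩
    have := hbound G' hG'
    rw [← h2] at this
    exact_mod_cast this
  have hopt1 := hmk _ hc1 hcM
  have hcls : ∀ G' : SimpleGraph (Fin n), MOptimal m G' →
      Nonempty (G' ≃g quasiComplete n k j) ∨ (j = 3 ∧ Nonempty (G' ≃g quasiComplete3 n k)) ∨
      Hval G' < Hval (quasiComplete n k j) := by
    intro G' hG'
    obtain ⟨b, ⟨e⟩⟩ := ZG.opt_TG hG'
    have h1 : ZG.E b n = m := by rw [← ZG.edge_TG, ← ZG.iso_edge e, hG'.1]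
    have hH : Hval G' = ZG.Hs b n := by rw [ZG.iso_H e, ZG.H_TG]
    have ho : ZG.Opt b n := by
      have h2 : (M1 (quasiComplete n k j) : ℤ) ≤ M1 G' := by exact_mod_cast hG'.2 _ hc1
      rw [hcM, ZG.iso_M1 e, ZG.M1_TG] at h2
      rw [ZG.Opt, hmx b h1]
      exact h2
    rcases ZG.classify n b ho with ⟨-, a, t, hta, hrp, hF⟩ | ⟨-, a, t, hta, hrp, hF⟩
    · rw [h1] at hrp
      obtain ⟨r1, r2⟩ := ZG.rep_unique hta hrp
      obtain ⟨r3, r4⟩ := ZG.rep_unique (by omega : k - j < k) hrep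
      have ea : a = k := by omega
      have et : t = k - j := by omega
      subst ea
      subst et
      have hf1 : ZG.F1 n a (a-j) b → Nonempty (G' ≃g quasiComplete n a j) := by
        intro hF
        have : ZG.TG n b = ZG.TG n (ZG.bC1 a j) := ZG.TG_congr (fun v hv hv' => by
          rw [hF.2.2 v hv hv', (ZG.F1_bC1 hjk hkn).2.2 v hv hv'])
        rw [this] at e
        exact ⟨e.trans e1.symm⟩
      rcases hF with hF | hF | hF
      · exact Or.inl (hf1 hF)
      · by_cases ht : a - j ≤ 1
        · exact Or.inl (hf1 (ZG.F2_F1 hta ht hF))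
        · right; right
          have := ZG.F2_lt (by omega) (by omega) hF
          omega
      · right; left
        have hj3 : j = 3 := by have := hF.1; omega
        refine ⟨hj3, ?_⟩
        have hk3 : 3 ≤ a := by omega
        obtain ⟨e3⟩ := ZG.iso3 hk3 hkn
        have : ZG.TG n b = ZG.TG n (ZG.bC3 a) := ZG.TG_congr (fun v hv hv' => by
          rw [hF.2.2 v hv hv', (ZG.F3_bC3 hk3 hkn).2.2 v hv hv'])
        rw [this] at e
        exact ⟨e.trans e3.symm⟩
    · right; right
      have h1 := ZG.bal b n
      have h2 : ZG.E (ZG.nb b) n = q := by omega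
      rw [h2] at hrp
      obtain ⟨r1, r2⟩ := ZG.regime hn hta hrp (by omega) (by omega)
      have := ZG.crude_lt (i := k - j) hn hta r1 hF r2 hk7
      omega
  constructor
  · intro hj3
    subst hj3
    obtain ⟨e3⟩ := ZG.iso3 hjk hkn
    obtain ⟨u1, u2, u3⟩ := ZG.F3_vals (ZG.F3_bC3 hjk hkn)
    have hopt3 : MOptimal m (quasiComplete3 n k) := by
      apply hmk
      · rw [ZG.iso_edge e3, ZG.edge_TG]
        zify at hrep ⊢; linarith
      · rw [ZG.iso_M1 e3, ZG.M1_TG, u2, hCf]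
    have hH3 : Hval (quasiComplete n k 3) < Hval (quasiComplete3 n k) := by
      have : Hval (quasiComplete3 n k) = ZG.Hs (ZG.bC3 k) n := by rw [ZG.iso_H e3, ZG.H_TG]
      omega
    constructor
    · refine ⟨hopt3, fun G' hG' => ?_⟩
      rcases hcls G' hG' with ⟨⟨e⟩⟩ | ⟨-, ⟨e⟩⟩ | h
      · rw [ZG.iso_H e]; exact hH3.le
      · rw [ZG.iso_H e]
      · omega
    · intro G' hG'
      have h3 := hG'.2 _ hopt3
      rcases hcls G' hG'.1 with ⟨⟨e⟩⟩ | ⟨-, h⟩ | h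
      · rw [ZG.iso_H e] at h3; omega
      · exact h
      · omega
  · intro hj3
    constructor
    · refine ⟨hopt1, fun G' hG' => ?_⟩
      rcases hcls G' hG' with ⟨⟨e⟩⟩ | ⟨h, -⟩ | h
      · rw [ZG.iso_H e]
      · exact absurd h hj3
      · exact h.le
    · intro G' hG'
      have h3 := hG'.2 _ hopt1
      rcases hcls G' hG'.1 with h | ⟨h, -⟩ | h
      · exact h
      · exact absurd h hj3
      · omega
end
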